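/- arXiv:1402.2946 — 4 statements merged into one kernel-verified Lean document; each statement's English description precedes it below -/
import Mathlib

section
/- For all integers a ≥ 0, b ≥ 0 and every g ∈ Λ_F: D_a(v⁽⁰⁾_b · g) = v⁽⁰⁾_b · (D_a g) + v⁽⁰⁾_{b−1} · (D_{a−1} g), with the conventions v⁽⁰⁾_{−1} := 0 and D_{−1} := 0. -/
noncomputable section
open scoped BigOperators
set_option maxHeartbeats 1000000
set_option synthInstance.maxHeartbeats 400000

/-- The field `F = ℚ(q,t)` of rational functions in two indeterminates. -/
abbrev F : Type := FractionRing (MvPolynomial (Fin 2) ℚ)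

/-- The indeterminate `q`. -/
def q : F := algebraMap (MvPolynomial (Fin 2) ℚ) F (MvPolynomial.X 0)

/-- The indeterminate `t`. -/
def t : F := algebraMap (MvPolynomial (Fin 2) ℚ) F (MvPolynomial.X 1)

/-- The ring `Λ_F = F[p₁, p₂, …]` of symmetric functions (polynomials in the power sums). -/
abbrev SF : Type := MvPolynomial ℕ+ F

/-- The power sum `p_n` (junk value `1` for `n = 0`). -/
def pvar (n : ℕ) : SF := if h : 0 < n then MvPolynomial.X ⟨n, h⟩ else 1

/-- Multiplication by `p_n` as a linear operator. -/
def mulP (n : ℕ) : Module.End F SF := LinearMap.mulLeft F (pvar n)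

/-- The derivation `∂/∂p_n` as a linear operator (junk value `0` for `n = 0`). -/
def pd (n : ℕ) : Module.End F SF :=
  if h : 0 < n then (MvPolynomial.pderiv (⟨n, h⟩ : ℕ+)).toLinearMap else 0

/-- The coefficient of `z^d` in `exp (∑_{n>0} A n z^n)`, where the `A n` are pairwise
commuting operators: it equals `∑_k (1/k!) ∑_{n₁+⋯+n_k = d, nᵢ ≥ 1} A n₁ ⋯ A n_k`,
a sum over compositions of `d`. -/
def expCoeff (A : ℕ → Module.End F SF) (d : ℕ) : Module.End F SF :=
  ∑ c : Composition d, ((c.length.factorial : F)⁻¹) • (c.blocks.map A).prod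

/-- `D_d`, the coefficient of `z^{-d}` in `D(z) = exp (∑_{n>0} (1-q^n) ∂_{p_n} z^{-n})`. -/
def Dop (d : ℕ) : Module.End F SF := expCoeff (fun n => (1 - q ^ n) • pd n) d

/-- The coefficient of `z^a` in `exp (∑_{n>0} ((1-t^{-n})/n) p_n z^n)`. -/
def Pplus (a : ℕ) : Module.End F SF :=
  expCoeff (fun n => ((1 - t⁻¹ ^ n) / (n : F)) • mulP n) a

/-- The coefficient of `z^{-b}` in `exp (-∑_{n>0} (1-q^n) ∂_{p_n} z^{-n})`. -/
def Nminus (b : ℕ) : Module.End F SF :=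
  expCoeff (fun n => (-(1 - q ^ n)) • pd n) b

/-- The weighted total degree of `f`, with `p_n` of degree `n`. -/
def wdeg (f : SF) : ℕ := MvPolynomial.weightedTotalDegree (fun n : ℕ+ => (n : ℕ)) f

/-- `η_d f`: the coefficient of `z^{-d}` in `η(z) f`, where
`η(z) = exp (∑_{n>0} ((1-t^{-n})/n) p_n z^n) ⬝ exp (-∑_{n>0} (1-q^n) ∂_{p_n} z^{-n})`.
Only the terms with `b ≤ wdeg f` contribute, since the degree-lowering part kills `f`
beyond that range. -/
def eta (d : ℤ) (f : SF) : SF :=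
  ∑ b ∈ Finset.range (wdeg f + 1),
    if d ≤ (b : ℤ) then Pplus ((b : ℤ) - d).toNat (Nminus b f) else 0

/-- The coefficient of `w^n` in `exp (∑_{m>0} a m w^m)` for commuting elements `a m`. -/
def expGF (a : ℕ → SF) (n : ℕ) : SF :=
  ∑ c : Composition n, ((c.length.factorial : F)⁻¹) • (c.blocks.map a).prod

/-- `v⁽⁰⁾_n`, defined by `∑_{n≥0} (-w)^n v⁽⁰⁾_n = exp (-∑_{m>0} p_m w^m/(m(1-q^m)))`. -/
def v0 (n : ℕ) : SF :=
  (-1 : SF) ^ n * expGF (fun m => -(((m : F) * (1 - q ^ m))⁻¹ • pvar m)) n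

/-- `v^{(∞)}_n`, defined by `∑_{n≥0} w^n v^{(∞)}_n = exp (∑_{m>0} p_m w^m/(m(1-q^m)))`. -/
def vInf (n : ℕ) : SF :=
  expGF (fun m => ((m : F) * (1 - q ^ m))⁻¹ • pvar m) n

/-- `v⁽⁰⁾_n` for `n ∈ ℤ`, with the convention `v⁽⁰⁾_n = 0` for `n < 0`. -/
def v0Z (n : ℤ) : SF := if 0 ≤ n then v0 n.toNat else 0

/-- `D_d` for `d ∈ ℤ`, with the convention `D_d = 0` for `d < 0`. -/
def DopZ (d : ℤ) : Module.End F SF := if 0 ≤ d then Dop d.toNat else 0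

/-- Splitting off the first block of a composition. -/
theorem Composition.sum_blocks_succ {M : Type*} [AddCommMonoid M] (f : List ℕ → M) (d : ℕ) :
    ∑ c : Composition (d + 1), f c.blocks =
      ∑ i ∈ Finset.range (d + 1), ∑ c : Composition (d - i), f ((i + 1) :: c.blocks) := by
  rw [Finset.sum_sigma']
  symm
  refine Finset.sum_bij
    (fun x hx => (⟨(x.1 + 1) :: x.2.blocks, ?_, ?_⟩ : Composition (d + 1))) ?_ ?_ ?_ ?_
  · intro j hj
    rcases List.mem_cons.1 hj with rfl | h
    · exact Nat.succ_pos _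
    · exact x.2.blocks_pos h
  · have h := Finset.mem_range.1 (Finset.mem_sigma.1 hx).1
    rw [List.sum_cons, x.2.blocks_sum]
    omega
  · intros
    exact Finset.mem_univ _
  · rintro ⟨i, c⟩ _ ⟨j, c'⟩ _ h
    have h' := congrArg Composition.blocks h
    simp only [List.cons.injEq, add_left_inj] at h'
    obtain ⟨rfl, h2⟩ := h'
    rw [Composition.ext h2]
  · intro c _
    obtain ⟨l, hl, hs⟩ := c
    cases l with
    | nil => simp at hs
    | cons x l =>
      have hx : 0 < x := hl (List.mem_cons_self)
      rw [List.sum_cons] at hs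
      refine ⟨⟨x - 1, ⟨l, fun h => hl (List.mem_cons_of_mem _ h), by omega⟩⟩, ?_, ?_⟩
      · simp only [Finset.mem_sigma, Finset.mem_range, Finset.mem_univ, and_true]
        omega
      · apply Composition.ext
        simp only [List.cons.injEq, and_true]
        omega
  · intros
    rfl

/-- The coefficient of `z^d` in `(∑_{n>0} a n z^n)^k`. -/
def powCoeff {R : Type*} [Ring R] (a : ℕ → R) (k d : ℕ) : R :=
  ∑ c : Composition d, if c.blocks.length = k then (c.blocks.map a).prod else 0

section PowCoeff

variable {R : Type*} [Ring R] (a : ℕ → R)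

theorem powCoeff_zero_succ (d : ℕ) : powCoeff a 0 (d + 1) = 0 := by
  unfold powCoeff
  rw [Composition.sum_blocks_succ (fun l => if l.length = 0 then (l.map a).prod else 0)]
  simp

theorem powCoeff_succ_succ (k d : ℕ) : powCoeff a (k + 1) (d + 1) =
    ∑ i ∈ Finset.range (d + 1), a (i + 1) * powCoeff a k (d - i) := by
  unfold powCoeff
  rw [Composition.sum_blocks_succ (fun l => if l.length = k + 1 then (l.map a).prod else 0)]
  simp [Finset.mul_sum]

theorem powCoeff_eq_zero {k d : ℕ} (h : d < k) : powCoeff a k d = 0 := by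
  refine Finset.sum_eq_zero fun c _ => if_neg ?_
  have := c.length_le
  have : c.blocks.length = c.length := rfl
  omega

theorem succ_smul_powCoeff (hc : ∀ i j, a i * a j = a j * a i) (k : ℕ) : ∀ d : ℕ,
    (d + 1) • powCoeff a (k + 1) (d + 1) =
      (k + 1) • ∑ i ∈ Finset.range (d + 1), (i + 1) • (a (i + 1) * powCoeff a k (d - i)) := by
  induction k with
  | zero =>
    intro d
    rw [powCoeff_succ_succ, Finset.sum_range_succ, Finset.sum_range_succ, Finset.sum_eq_zero,
      Finset.sum_eq_zero]
    · simp
    all_goals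
      intro i hi
      obtain ⟨e, he⟩ : ∃ e, d - i = e + 1 := ⟨d - i - 1, by have := Finset.mem_range.1 hi; omega⟩
      simp [he, powCoeff_zero_succ]
  | succ k ih =>
    intro d
    have key : ∀ n : ℕ, n • powCoeff a (k + 1) n =
        (k + 1) • ∑ j ∈ Finset.range n, (j + 1) • (a (j + 1) * powCoeff a k (n - 1 - j)) := by
      rintro (_ | n)
      · simp
      · exact ih n
    have hsplit : ∀ i ∈ Finset.range (d + 1),
        (d + 1) • (a (i + 1) * powCoeff a (k + 1) (d - i)) =
          (i + 1) • (a (i + 1) * powCoeff a (k + 1) (d - i)) +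
            (k + 1) • ∑ j ∈ Finset.range (d - i),
              (j + 1) • (a (i + 1) * (a (j + 1) * powCoeff a k (d - i - 1 - j))) := by
      intro i hi
      have : d + 1 = (i + 1) + (d - i) := by have := Finset.mem_range.1 hi; omega
      rw [this, add_smul, ← mul_smul_comm (d - i), key, mul_smul_comm, Finset.mul_sum]
      simp only [mul_smul_comm]
    rw [powCoeff_succ_succ, Finset.smul_sum, Finset.sum_congr rfl hsplit, Finset.sum_add_distrib,
      ← Finset.smul_sum, add_comm, add_smul (k + 1) 1, one_smul]
    congr 2
    rw [Finset.sum_comm' (t' := Finset.range (d + 1)) (s' := fun j => Finset.range (d - j))]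
    · refine Finset.sum_congr rfl fun j hj => ?_
      rcases Nat.eq_zero_or_pos (d - j) with h0 | h0
      · simp [h0, powCoeff_eq_zero]
      · obtain ⟨e, he⟩ : ∃ e, d - j = e + 1 := ⟨d - j - 1, by omega⟩
        rw [he, powCoeff_succ_succ, Finset.mul_sum, Finset.smul_sum]
        refine Finset.sum_congr rfl fun i _ => ?_
        rw [← mul_assoc, ← mul_assoc, hc, show d - i - 1 - j = e - i by omega]
    · intro i j
      simp only [Finset.mem_range]
      omega

variable {K : Type*} [Field K] [Algebra K R]

theorem sum_composition_eq_sum_powCoeff {d N : ℕ} (h : d < N) :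
    ∑ c : Composition d, ((c.length.factorial : K)⁻¹) • (c.blocks.map a).prod =
      ∑ k ∈ Finset.range N, ((k.factorial : K)⁻¹) • powCoeff a k d := by
  simp only [powCoeff, Finset.smul_sum]
  rw [Finset.sum_comm]
  refine Finset.sum_congr rfl fun c _ => ?_
  have hl : c.blocks.length = c.length := rfl
  have := c.length_le
  rw [Finset.sum_eq_single c.length]
  · rw [if_pos hl]
  · intro k _ hk
    rw [if_neg (fun h => hk (by omega)), smul_zero]
  · intro h'
    exact absurd (Finset.mem_range.2 (by omega)) h'

theorem succ_nsmul_sum_composition [CharZero K] (hc : ∀ i j, a i * a j = a j * a i) (d : ℕ) :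
    (d + 1) • ∑ c : Composition (d + 1),
        ((c.length.factorial : K)⁻¹) • (c.blocks.map a).prod =
      ∑ i ∈ Finset.range (d + 1), (i + 1) • (a (i + 1) *
        ∑ c : Composition (d - i), ((c.length.factorial : K)⁻¹) • (c.blocks.map a).prod) := by
  rw [sum_composition_eq_sum_powCoeff a (Nat.lt_succ_self (d + 1)), Finset.sum_range_succ',
    powCoeff_zero_succ, smul_zero, add_zero, Finset.smul_sum]
  have h1 : ∀ k ∈ Finset.range (d + 1),
      (d + 1) • (((k + 1).factorial : K)⁻¹ • powCoeff a (k + 1) (d + 1)) =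
        ∑ i ∈ Finset.range (d + 1),
          (i + 1) • (a (i + 1) * (((k.factorial : K)⁻¹) • powCoeff a k (d - i))) := by
    intro k _
    rw [smul_comm, succ_smul_powCoeff a hc, ← Nat.cast_smul_eq_nsmul K (k + 1), smul_smul,
      show (((k + 1).factorial : K)⁻¹ * ((k + 1 : ℕ) : K)) = (k.factorial : K)⁻¹ by
        have := Nat.cast_ne_zero (R := K).2 k.succ_ne_zero
        have := Nat.cast_ne_zero (R := K).2 k.factorial_ne_zero
        rw [Nat.factorial_succ, Nat.cast_mul]
        field_simp, Finset.smul_sum]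
    refine Finset.sum_congr rfl fun i _ => ?_
    rw [smul_comm, mul_smul_comm]
  rw [Finset.sum_congr rfl h1, Finset.sum_comm]
  refine Finset.sum_congr rfl fun i _ => ?_
  rw [sum_composition_eq_sum_powCoeff a (show d - i < d + 1 by omega), Finset.mul_sum,
    Finset.smul_sum]

/-- The coefficients of `E = exp A` satisfy `z E' = (z A') E`. -/
theorem succ_smul_sum_composition [CharZero K] (hc : ∀ i j, a i * a j = a j * a i) (d : ℕ) :
    ((d + 1 : ℕ) : K) • ∑ c : Composition (d + 1),
        ((c.length.factorial : K)⁻¹) • (c.blocks.map a).prod =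
      ∑ i ∈ Finset.range (d + 1), ((i + 1 : ℕ) : K) • (a (i + 1) *
        ∑ c : Composition (d - i), ((c.length.factorial : K)⁻¹) • (c.blocks.map a).prod) := by
  simp only [Nat.cast_smul_eq_nsmul]
  exact succ_nsmul_sum_composition a hc d

theorem sum_composition_zero :
    ∑ c : Composition 0, ((c.length.factorial : K)⁻¹) • (c.blocks.map a).prod = 1 := by
  have h : ∀ c : Composition 0, c.blocks = [] := fun c =>
    List.length_eq_zero_iff.1 (Nat.le_zero.1 c.length_le)
  have hu : Subsingleton (Composition 0) := ⟨fun c c' => Composition.ext ((h c).trans (h c').symm)⟩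
  rw [Fintype.sum_subsingleton _ (Composition.ones 0)]
  simp [Composition.length, h]

theorem Module.End.succ_smul_sum_composition_apply [CharZero K] {M : Type*} [AddCommGroup M]
    [Module K M] (A : ℕ → Module.End K M) (hc : ∀ i j, A i * A j = A j * A i) (d : ℕ) (g : M) :
    ((d + 1 : ℕ) : K) • (∑ c : Composition (d + 1),
        ((c.length.factorial : K)⁻¹) • (c.blocks.map A).prod) g =
      ∑ i ∈ Finset.range (d + 1), ((i + 1 : ℕ) : K) • A (i + 1) ((∑ c : Composition (d - i),
        ((c.length.factorial : K)⁻¹) • (c.blocks.map A).prod) g) := by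
  exact (DFunLike.congr_fun (succ_smul_sum_composition (K := K) A hc d) g).trans
    (LinearMap.sum_apply _ _ _)

end PowCoeff

section ExpDerivation

variable {K S : Type*} [Field K] [CharZero K] [CommRing S] [Algebra K S]
  (B : ℕ → Derivation K S S)

/-- If `B_n a_m = -δ_{mn}` then `B_n` acts on `∑ e_b w^b = exp (∑ a_m w^m)` as multiplication
by `-w^n`. The index of `B` is shifted by one. -/
theorem Derivation.apply_exp_coeff {a e : ℕ → S} (he0 : e 0 = 1)
    (he : ∀ d : ℕ, ((d + 1 : ℕ) : K) • e (d + 1) =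
      ∑ i ∈ Finset.range (d + 1), ((i + 1 : ℕ) : K) • (a (i + 1) * e (d - i)))
    (ha : ∀ n m, B n (a (m + 1)) = if m = n then -1 else 0) (n b : ℕ) :
    B n (e b) = if n < b then -e (b - (n + 1)) else 0 := by
  induction b using Nat.strong_induction_on with
  | _ b ih =>
  rcases b with _ | b
  · simp [he0]
  have hterm : ∀ i ∈ Finset.range (b + 1),
      B n (((i + 1 : ℕ) : K) • (a (i + 1) * e (b - i))) =
        -(if n < b - i then
          ((i + 1 : ℕ) : K) • (a (i + 1) * e (b - i - (n + 1))) else 0) +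
        (if i = n then -(((n + 1 : ℕ) : K) • e (b - n)) else 0) := by
    intro i hi
    rw [map_smul, Derivation.leibniz, ha, ih (b - i) (by omega), smul_eq_mul, smul_eq_mul,
      smul_add]
    congr 1
    · split_ifs
      · rw [mul_neg, smul_neg]
      · simp
    · split_ifs with h
      · rw [h, mul_neg_one, smul_neg]
      · simp
  have hsum : ((b + 1 : ℕ) : K) • B n (e (b + 1)) =
      ((b + 1 : ℕ) : K) • (if n < b + 1 then -e (b + 1 - (n + 1)) else 0) := by
    rw [← map_smul, he, map_sum, Finset.sum_congr rfl hterm, Finset.sum_add_distrib,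
      Finset.sum_neg_distrib, Finset.sum_ite_eq' (Finset.range (b + 1))]
    simp only [Finset.mem_range]
    split_ifs with hn
    · obtain ⟨r, rfl⟩ := Nat.exists_eq_add_of_le (Nat.lt_succ_iff.1 hn)
      have h1 : ∑ i ∈ Finset.range (n + r + 1), (if n < n + r - i then
          ((i + 1 : ℕ) : K) • (a (i + 1) * e (n + r - i - (n + 1))) else 0) =
            (r : K) • e r := by
        rcases r with _ | r
        · rw [Nat.cast_zero, zero_smul]
          exact Finset.sum_eq_zero fun i _ => if_neg (by omega)
        · rw [he, ← Finset.sum_filter]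
          refine Finset.sum_congr ?_ fun i _ => ?_
          · ext i
            simp only [Finset.mem_filter, Finset.mem_range]
            omega
          · rw [show n + (r + 1) - i - (n + 1) = r - i by omega]
      rw [h1, show n + r - n = r by omega, show n + r + 1 - (n + 1) = r by omega, smul_neg,
        ← neg_add, ← add_smul]
      congr 2
      push_cast
      ring
    · rw [Finset.sum_eq_zero fun i _ => if_neg (by omega)]
      simp
  exact smul_right_injective S (Nat.cast_ne_zero (R := K).2 (Nat.succ_ne_zero b)) hsum

/-- If `B_n` acts on `∑ (-w)^b v_b` as multiplication by `-w^n`, then `exp (∑ (B_n / n) z^n)`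
twists multiplication by this series by the factor `1 - w z`. The index of `B` is shifted by
one, and `D' d` stands for `D (d - 1)`. -/
theorem Derivation.exp_mul_apply {D D' : ℕ → S → S} {v : ℤ → S}
    (hD0 : ∀ g, D 0 g = g)
    (hD : ∀ d g, ((d + 1 : ℕ) : K) • D (d + 1) g =
      ∑ i ∈ Finset.range (d + 1), B i (D (d - i) g))
    (hD'0 : ∀ g, D' 0 g = 0) (hD' : ∀ d g, D' (d + 1) g = D d g)
    (hv : ∀ n b, B n (v b) = (-1) ^ n * v (b - 1 - n)) (a : ℕ) (b : ℤ) (g : S) :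
    D a (v b * g) = v b * D a g + v (b - 1) * D' a g := by
  induction a using Nat.strong_induction_on with
  | _ a ih =>
  rcases a with _ | a
  · simp [hD0, hD'0]
  have hterm : ∀ i ∈ Finset.range (a + 1),
      B i (D (a - i) (v b * g)) =
        v b * B i (D (a - i) g) + v (b - 1) * B i (D' (a - i) g) +
        ((-1) ^ i * v (b - 1 - i) * D (a - i) g +
          (-1) ^ i * v (b - 1 - 1 - i) * D' (a - i) g) := by
    intro i _
    rw [ih _ (by omega), map_add, Derivation.leibniz, Derivation.leibniz, hv, hv]
    simp only [smul_eq_mul]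
    ring
  have h1 : ∑ i ∈ Finset.range (a + 1), B i (D' (a - i) g) = (a : K) • D a g := by
    rw [Finset.sum_range_succ, Nat.sub_self, hD'0, map_zero, add_zero]
    rcases a with _ | a
    · simp
    · rw [hD]
      refine Finset.sum_congr rfl fun i hi => ?_
      rw [Nat.succ_sub (Nat.lt_succ_iff.1 (Finset.mem_range.1 hi)), hD']
  have htel : ∑ i ∈ Finset.range (a + 1), ((-1) ^ i * v (b - 1 - i) * D (a - i) g +
      (-1) ^ i * v (b - 1 - 1 - i) * D' (a - i) g) = v (b - 1) * D a g := by
    rw [Finset.sum_add_distrib, Finset.sum_range_succ', Finset.sum_range_succ _ a,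
      add_add_add_comm, ← Finset.sum_add_distrib, Finset.sum_eq_zero]
    · simp [hD'0]
    · intro i hi
      have := Finset.mem_range.1 hi
      rw [show a - i = a - (i + 1) + 1 by omega, hD',
        show b - 1 - ((i + 1 : ℕ) : ℤ) = b - 1 - 1 - i by push_cast; ring]
      ring
  have hsum : ((a + 1 : ℕ) : K) • D (a + 1) (v b * g) =
      ((a + 1 : ℕ) : K) • (v b * D (a + 1) g + v (b - 1) * D' (a + 1) g) := by
    rw [hD, Finset.sum_congr rfl hterm, Finset.sum_add_distrib,
      Finset.sum_add_distrib, ← Finset.mul_sum, ← Finset.mul_sum, ← hD, h1, htel,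
      smul_add, mul_smul_comm, mul_smul_comm, hD', Nat.cast_succ a,
      add_smul (a : K) 1 (v (b - 1) * D a g), one_smul, add_assoc]
  exact smul_right_injective S (Nat.cast_ne_zero (R := K).2 (Nat.succ_ne_zero a)) hsum

end ExpDerivation

theorem one_sub_q_pow_ne_zero {n : ℕ} (hn : n ≠ 0) : (1 : F) - q ^ n ≠ 0 := by
  intro h
  have h1 : algebraMap (MvPolynomial (Fin 2) ℚ) F (MvPolynomial.X 0 ^ n) =
      algebraMap (MvPolynomial (Fin 2) ℚ) F 1 := by
    rw [map_pow, map_one]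
    exact (sub_eq_zero.1 h).symm
  have h2 := congrArg (MvPolynomial.eval (fun _ => (0 : ℚ)))
    (IsFractionRing.injective (MvPolynomial (Fin 2) ℚ) F h1)
  simp [hn] at h2

theorem pd_zero : pd 0 = 0 :=
  dif_neg (lt_irrefl 0)

theorem pd_succ (n : ℕ) (f : SF) : pd (n + 1) f = MvPolynomial.pderiv n.succPNat f := by
  have h : pd (n + 1) = (MvPolynomial.pderiv n.succPNat).toLinearMap := dif_pos n.succ_pos
  rw [h]
  rfl

theorem pvar_succ (n : ℕ) : pvar (n + 1) = MvPolynomial.X n.succPNat :=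
  dif_pos n.succ_pos

theorem MvPolynomial.pderiv_comm {σ R : Type*} [CommRing R] (i j : σ) (f : MvPolynomial σ R) :
    pderiv i (pderiv j f) = pderiv j (pderiv i f) := by
  classical
  have h : ⁅(pderiv i : Derivation R (MvPolynomial σ R) (MvPolynomial σ R)),
      (pderiv j : Derivation R (MvPolynomial σ R) (MvPolynomial σ R))⁆ = 0 := by
    refine derivation_ext fun k => ?_
    simp [Derivation.commutator_apply, pderiv_X, Pi.single_apply, apply_ite]
  have hf := DFunLike.congr_fun h f
  rwa [Derivation.commutator_apply, Derivation.zero_apply, sub_eq_zero] at hf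

theorem pd_mul_comm (i j : ℕ) : pd i * pd j = pd j * pd i := by
  rcases i with _ | i
  · rw [pd_zero, zero_mul, mul_zero]
  rcases j with _ | j
  · rw [pd_zero, zero_mul, mul_zero]
  refine LinearMap.ext fun f => ?_
  rw [Module.End.mul_apply, Module.End.mul_apply, pd_succ, pd_succ, pd_succ, pd_succ,
    MvPolynomial.pderiv_comm]

theorem Dop_zero (g : SF) : Dop 0 g = g :=
  DFunLike.congr_fun (sum_composition_zero (K := F) (fun n => (1 - q ^ n) • pd n)) g

/-- The derivation `n (1 - q^n) ∂_{p_n}`, with the index `n` shifted by one. -/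
def scaledPderiv (i : ℕ) : Derivation F SF SF :=
  (((i + 1 : ℕ) : F) * (1 - q ^ (i + 1))) • MvPolynomial.pderiv i.succPNat

theorem scaledPderiv_apply (i : ℕ) (f : SF) :
    scaledPderiv i f = ((i + 1 : ℕ) : F) • ((1 - q ^ (i + 1)) • pd (i + 1)) f := by
  rw [LinearMap.smul_apply, pd_succ, smul_smul]
  rfl

theorem succ_smul_Dop (d : ℕ) (g : SF) : ((d + 1 : ℕ) : F) • Dop (d + 1) g =
    ∑ i ∈ Finset.range (d + 1), scaledPderiv i (Dop (d - i) g) := by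
  have hc : ∀ i j, ((1 - q ^ i) • pd i) * ((1 - q ^ j) • pd j) =
      ((1 - q ^ j) • pd j) * ((1 - q ^ i) • pd i) := fun i j => by
    rw [smul_mul_smul_comm, smul_mul_smul_comm, mul_comm (1 - q ^ i), pd_mul_comm]
  refine (Module.End.succ_smul_sum_composition_apply (K := F)
    (fun n => (1 - q ^ n) • pd n) hc d g).trans ?_
  exact Finset.sum_congr rfl fun i _ => (scaledPderiv_apply i _).symm

theorem scaledPderiv_apply_pvar (n m : ℕ) :
    scaledPderiv n (-((((m + 1 : ℕ) : F) * (1 - q ^ (m + 1)))⁻¹ • pvar (m + 1))) =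
      if m = n then -1 else 0 := by
  rw [pvar_succ, map_neg, Derivation.map_smul, scaledPderiv, Derivation.smul_apply]
  split_ifs with h
  · subst h
    rw [MvPolynomial.pderiv_X_self, smul_smul, inv_mul_cancel₀, one_smul]
    exact mul_ne_zero (Nat.cast_ne_zero.2 m.succ_ne_zero) (one_sub_q_pow_ne_zero m.succ_ne_zero)
  · rw [MvPolynomial.pderiv_X_of_ne fun h' => h (Nat.succPNat_inj.1 h'), smul_zero, smul_zero,
      neg_zero]

theorem v0Z_natCast (b : ℕ) : v0Z b = v0 b :=
  if_pos (Int.natCast_nonneg b)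

theorem v0Z_of_neg {b : ℤ} (hb : b < 0) : v0Z b = 0 :=
  if_neg (not_le.2 hb)

theorem scaledPderiv_v0Z (n : ℕ) (b : ℤ) :
    scaledPderiv n (v0Z b) = (-1) ^ n * v0Z (b - 1 - n) := by
  rcases lt_or_ge b 0 with hb | hb
  · rw [v0Z_of_neg hb, v0Z_of_neg (by omega), map_zero, mul_zero]
  lift b to ℕ using hb
  have hpow : ∀ (k : ℕ) (f : SF), scaledPderiv n ((-1) ^ k * f) = (-1) ^ k * scaledPderiv n f := by
    intro k f
    rcases neg_one_pow_eq_or SF k with h | h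
    · rw [h, one_mul, one_mul]
    · rw [h, neg_one_mul, neg_one_mul, map_neg]
  have hexp := Derivation.apply_exp_coeff scaledPderiv
    (a := fun m => -(((m : F) * (1 - q ^ m))⁻¹ • pvar m))
    (e := expGF (fun m => -(((m : F) * (1 - q ^ m))⁻¹ • pvar m)))
    (sum_composition_zero (K := F) _)
    (succ_smul_sum_composition (K := F) _ (fun _ _ => mul_comm _ _))
    scaledPderiv_apply_pvar n b
  rw [v0Z_natCast, v0, hpow, hexp]
  split_ifs with h
  · obtain ⟨r, rfl⟩ := Nat.exists_eq_add_of_lt h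
    rw [show ((n + r + 1 : ℕ) : ℤ) - 1 - n = (r : ℕ) by push_cast; ring, v0Z_natCast, v0,
      show n + r + 1 - (n + 1) = r by omega]
    generalize expGF _ r = x
    ring
  · rw [v0Z_of_neg (by omega), mul_zero, mul_zero]

/-- For all integers `a ≥ 0`, `b ≥ 0` and every `g ∈ Λ_F`:
`D_a (v⁽⁰⁾_b ⬝ g) = v⁽⁰⁾_b ⬝ (D_a g) + v⁽⁰⁾_{b-1} ⬝ (D_{a-1} g)`,
with the conventions `v⁽⁰⁾_{-1} = 0` and `D_{-1} = 0`. -/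
theorem stmt3 (a b : ℕ) (g : SF) :
    Dop a (v0 b * g) =
      v0 b * Dop a g + v0Z ((b : ℤ) - 1) * DopZ ((a : ℤ) - 1) g := by
  have hDZ : ∀ d g, DopZ (((d + 1 : ℕ) : ℤ) - 1) g = Dop d g := fun d g => by
    rw [Nat.cast_succ, add_sub_cancel_right, DopZ, if_pos (Int.natCast_nonneg d), Int.toNat_natCast]
  rw [← v0Z_natCast]
  exact Derivation.exp_mul_apply (K := F) scaledPderiv (D := fun d g => Dop d g)
    (D' := fun d g => DopZ ((d : ℤ) - 1) g) (v := v0Z) Dop_zero succ_smul_Dop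
    (fun _ => rfl) hDZ scaledPderiv_v0Z a b g
end
end

section
/- For all integers a ∈ ℤ, b ≥ 0 and every g ∈ Λ_F: η_a(v^{(∞)}_b · g) = v^{(∞)}_b · (η_a g) − v^{(∞)}_{b−1} · (η_{a−1} g), with the convention v^{(∞)}_{−1} := 0. -/
noncomputable section
open scoped BigOperators
set_option maxHeartbeats 1000000
set_option synthInstance.maxHeartbeats 400000

/-- `v^{(∞)}_n` for `n ∈ ℤ`, with the convention `v^{(∞)}_n = 0` for `n < 0`. -/
def vInfZ (n : ℤ) : SF := if 0 ≤ n then vInf n.toNat else 0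

namespace PowerSeries

section Euler

variable {R : Type*} [Semiring R]

/-- The Euler operator `X ⬝ d/dX` on power series. -/
def euler (f : PowerSeries R) : PowerSeries R := mk fun n => n • coeff n f

theorem coeff_euler (f : PowerSeries R) (n : ℕ) : coeff n (euler f) = n • coeff n f :=
  coeff_mk _ _

theorem euler_mul (f g : PowerSeries R) : euler (f * g) = euler f * g + f * euler g := by
  ext n
  simp only [coeff_euler, map_add, coeff_mul, Finset.smul_sum, ← Finset.sum_add_distrib]
  refine Finset.sum_congr rfl fun p hp => ?_
  rw [← Finset.HasAntidiagonal.mem_antidiagonal.mp hp, add_smul, smul_mul_assoc, mul_smul_comm]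

theorem euler_pow_succ {f : PowerSeries R} (h : Commute f (euler f)) (k : ℕ) :
    euler (f ^ (k + 1)) = (k + 1) • (euler f * f ^ k) := by
  induction k with
  | zero => simp
  | succ k ih =>
    rw [pow_succ, euler_mul, ih, (h.pow_left (k + 1)).eq, smul_mul_assoc, mul_assoc, ← pow_succ,
      ← succ_nsmul]

theorem euler_C (a : R) : euler (C a) = 0 := by
  ext n
  rcases n with _ | n <;> simp [coeff_euler, coeff_C]

theorem euler_X : euler (X : PowerSeries R) = X := by
  ext n
  rw [coeff_euler, coeff_X]
  split_ifs with h <;> simp [h]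

theorem euler_sub {R : Type*} [Ring R] (f g : PowerSeries R) :
    euler (f - g) = euler f - euler g := by
  ext n
  simp only [coeff_euler, map_sub, smul_sub]

/-- A linear differential equation `X f' = B f` with `B(0) = 0` determines `f` from `f(0)`. -/
theorem eq_of_euler_eq_mul (K : Type*) {R : Type*} [Field K] [CharZero K] [Ring R] [Algebra K R]
    {B f g : PowerSeries R} (hB : coeff 0 B = 0)
    (hf : euler f = B * f) (hg : euler g = B * g) (h0 : coeff 0 f = coeff 0 g) : f = g := by
  ext n
  induction n using Nat.strong_induction_on with
  | _ n ih =>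
    rcases Nat.eq_zero_or_pos n with rfl | hn
    · exact h0
    have key : n • coeff n f = n • coeff n g := by
      rw [← coeff_euler, ← coeff_euler, hf, hg, coeff_mul, coeff_mul]
      refine Finset.sum_congr rfl fun p hp => ?_
      have hp' := Finset.HasAntidiagonal.mem_antidiagonal.mp hp
      rcases Nat.eq_zero_or_pos p.1 with h | h
      · rw [h, hB, zero_mul, zero_mul]
      · rw [ih p.2 (by omega)]
    rw [← Nat.cast_smul_eq_nsmul K, ← Nat.cast_smul_eq_nsmul K] at key
    exact smul_right_injective R (Nat.cast_ne_zero.mpr hn.ne' : (n : K) ≠ 0) key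

end Euler

section Exp

variable {K R : Type*} [Field K] [Ring R] [Algebra K R]

/-- The power series `∑_{n>0} A n X^n`. -/
def positivePart (A : ℕ → R) : PowerSeries R := mk fun n => if n = 0 then 0 else A n

theorem sum_composition_length_succ {M : Type*} [AddCommMonoid M] (f : List ℕ → M) (k n : ℕ) :
    ∑ c : Composition n with c.length = k + 1, f c.blocks =
      ∑ p ∈ Finset.HasAntidiagonal.antidiagonal n, if p.1 = 0 then 0 else
        ∑ c : Composition p.2 with c.length = k, f (p.1 :: c.blocks) := by
  simp_rw [← ite_not (p := _ = 0)]
  rw [← Finset.sum_filter, Finset.sum_sigma']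
  symm
  refine Finset.sum_bij
    (fun x hx => ⟨x.1.1 :: x.2.blocks, ?_, ?_⟩) ?_ ?_ ?_ ?_
  · intro i hi
    simp only [Finset.mem_sigma, Finset.mem_filter] at hx
    rcases List.mem_cons.mp hi with rfl | hi
    · exact Nat.pos_of_ne_zero hx.1.2
    · exact x.2.blocks_pos hi
  · simp only [Finset.mem_sigma, Finset.mem_filter, Finset.HasAntidiagonal.mem_antidiagonal] at hx
    simpa using hx.1.1
  · rintro ⟨p, c⟩ hx
    simpa [Composition.length] using (Finset.mem_sigma.mp hx).2
  · rintro ⟨⟨i, j⟩, c⟩ hc ⟨⟨i', j'⟩, c'⟩ hc' h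
    simp only [Finset.mem_sigma, Finset.mem_filter, Finset.HasAntidiagonal.mem_antidiagonal]
      at hc hc'
    simp only [Composition.mk.injEq, List.cons.injEq] at h
    obtain ⟨rfl, h⟩ := h
    obtain rfl : j = j' := by omega
    obtain rfl : c = c' := Composition.ext h
    rfl
  · rintro ⟨l, hl, hs⟩ hc
    rcases l with _ | ⟨i, l⟩
    · simp [Composition.length] at hc
    · refine ⟨⟨(i, l.sum), ⟨l, fun h => hl (List.mem_cons_of_mem _ h), rfl⟩⟩, ?_, rfl⟩
      have := hl List.mem_cons_self
      simp only [List.sum_cons] at hs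
      simpa [Composition.length, hs, this.ne'] using hc
  · rintro ⟨p, c⟩ _
    rfl

theorem coeff_positivePart_pow (A : ℕ → R) (k n : ℕ) :
    coeff n (positivePart A ^ k) =
      ∑ c : Composition n with c.length = k, (c.blocks.map A).prod := by
  induction k generalizing n with
  | zero =>
    rcases n with _ | n
    · have hl (c : Composition 0) : c.length = 0 := Nat.le_zero.mp c.length_le
      have hb (c : Composition 0) : c.blocks = [] := List.length_eq_zero_iff.mp (hl c)
      simp [hl, hb, composition_card]
    · rw [Finset.sum_eq_zero]
      · simp [coeff_one]
      · intro c hc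
        simp at hc
  | succ k ih =>
    rw [sum_composition_length_succ fun l => (l.map A).prod, pow_succ', coeff_mul]
    refine Finset.sum_congr rfl fun p _ => ?_
    rw [ih, positivePart, coeff_mk]
    split_ifs <;> simp [Finset.mul_sum]

variable (K) in
/-- The exponential of `∑_{n>0} A n X^n`, as a sum over compositions. -/
def expSeries (A : ℕ → R) : PowerSeries R :=
  mk fun n => ∑ c : Composition n, ((c.length.factorial : K)⁻¹) • (c.blocks.map A).prod

theorem coeff_expSeries (A : ℕ → R) {n N : ℕ} (h : n < N) :
    coeff n (expSeries K A) =
      ∑ k ∈ Finset.range N, ((k.factorial : K)⁻¹) • coeff n (positivePart A ^ k) := by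
  rw [expSeries, coeff_mk, ← Finset.sum_fiberwise_of_maps_to
    (t := Finset.range N) (g := fun c : Composition n => c.length)
    fun c _ => Finset.mem_range.mpr (c.length_le.trans_lt h)]
  refine Finset.sum_congr rfl fun k _ => ?_
  rw [coeff_positivePart_pow, Finset.smul_sum]
  refine Finset.sum_congr rfl fun c hc => ?_
  rw [(Finset.mem_filter.mp hc).2]

theorem coeff_zero_expSeries (A : ℕ → R) : coeff 0 (expSeries K A) = 1 := by
  simp [coeff_expSeries (K := K) A Nat.zero_lt_one]

theorem euler_expSeries [CharZero K] {A : ℕ → R} (hA : ∀ i j, Commute (A i) (A j)) :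
    euler (expSeries K A) = euler (positivePart A) * expSeries K A := by
  have hc : Commute (positivePart A) (euler (positivePart A)) := by
    have hcc : ∀ i j, Commute (coeff i (positivePart A)) (coeff j (positivePart A)) := by
      intro i j
      simp only [positivePart, coeff_mk]
      split_ifs <;> simp [hA i j]
    ext n
    rw [coeff_mul, coeff_mul, ← Finset.Nat.sum_antidiagonal_swap]
    refine Finset.sum_congr rfl fun p _ => ?_
    simp only [coeff_euler, Prod.fst_swap, Prod.snd_swap]
    exact ((hcc p.2 p.1).smul_right p.1).eq
  ext n
  have hfact (k : ℕ) : ((k + 1).factorial : K)⁻¹ * ((k + 1 : ℕ) : K) = (k.factorial : K)⁻¹ := by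
    rw [Nat.factorial_succ, Nat.cast_mul, mul_inv, mul_comm, ← mul_assoc,
      mul_inv_cancel₀ (Nat.cast_ne_zero.mpr k.succ_ne_zero), one_mul]
  rw [coeff_euler, coeff_expSeries A (show n < n + 1 + 1 by omega), Finset.smul_sum,
    Finset.sum_range_succ']
  have h0 : n • ((Nat.factorial 0 : K)⁻¹ • coeff n (positivePart A ^ 0)) = 0 := by
    rcases n with _ | n <;> simp [coeff_one]
  rw [h0, add_zero, coeff_mul]
  have hE : ∀ p ∈ Finset.HasAntidiagonal.antidiagonal n,
      coeff p.1 (euler (positivePart A)) * coeff p.2 (expSeries K A) =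
        ∑ k ∈ Finset.range (n + 1), (k.factorial : K)⁻¹ •
          (coeff p.1 (euler (positivePart A)) * coeff p.2 (positivePart A ^ k)) := by
    intro p hp
    have hp' := Finset.HasAntidiagonal.mem_antidiagonal.mp hp
    rw [coeff_expSeries A (show p.2 < n + 1 by omega), Finset.mul_sum]
    simp only [mul_smul_comm]
  rw [Finset.sum_congr rfl hE, Finset.sum_comm]
  refine Finset.sum_congr rfl fun k _ => ?_
  rw [← Finset.smul_sum, ← coeff_mul, smul_comm, ← coeff_euler, euler_pow_succ hc, map_nsmul,
    ← Nat.cast_smul_eq_nsmul K, smul_smul, hfact]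

/-- If the `A n` commute and `[n A n, M b] = -M (b - n)` for `n > 0`, then
`exp (∑ A n X^n) M b = (M b - X M (b - 1)) exp (∑ A n X^n)`. -/
theorem expSeries_mul_C [CharZero K] {A : ℕ → R} {M : ℤ → R} (hA : ∀ i j, Commute (A i) (A j))
    (hM : ∀ n : ℕ, n ≠ 0 → ∀ b, (n • A n) * M b = M b * (n • A n) - M (b - n)) (b : ℤ) :
    expSeries K A * C (M b) = (C (M b) - X * C (M (b - 1))) * expSeries K A := by
  set N := expSeries K A
  set B := euler (positivePart A) with hB
  set G : ℤ → PowerSeries R := fun b => mk fun k => if k = 0 then 0 else M (b - k) with hG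
  have hN : euler N = B * N := euler_expSeries hA
  have hBM (b : ℤ) : B * C (M b) = C (M b) * B - G b := by
    ext1 n
    rw [map_sub, coeff_mul_C, coeff_C_mul, hB, coeff_euler, positivePart, coeff_mk, hG, coeff_mk]
    split_ifs with h
    · simp
    · exact hM n h b
  have hGG (b : ℤ) : G b = X * (C (M (b - 1)) + G (b - 1)) := by
    ext1 n
    rcases n with _ | n
    · simp [hG]
    · rw [coeff_succ_X_mul, map_add, hG, coeff_mk, coeff_mk, coeff_C, if_neg n.succ_ne_zero]
      rcases n with _ | n
      · simp
      · simp only [Nat.succ_ne_zero, if_false, zero_add]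
        congr 1
        push_cast
        ring
  refine eq_of_euler_eq_mul K (B := B) ?_ ?_ ?_ ?_
  · rw [hB, coeff_euler, zero_smul]
  · rw [euler_mul, hN, euler_C, mul_zero, add_zero, mul_assoc]
  · have h1 : euler (C (M b) - X * C (M (b - 1))) = - (X * C (M (b - 1))) := by
      rw [euler_sub, euler_mul, euler_X, euler_C, euler_C, mul_zero, add_zero, zero_sub]
    have h2 : B * (C (M b) - X * C (M (b - 1))) =
        (C (M b) - X * C (M (b - 1))) * B - X * C (M (b - 1)) := by
      rw [mul_sub, ← mul_assoc, (commute_X B).eq, mul_assoc, hBM, hBM, hGG b]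
      noncomm_ring
    rw [euler_mul, h1, hN, ← mul_assoc B, h2]
    noncomm_ring
  · rw [coeff_mul_C, sub_mul, map_sub, coeff_C_mul, mul_assoc, coeff_zero_X_mul,
      coeff_zero_expSeries, one_mul, mul_one, sub_zero]

theorem coeff_succ_expSeries_mul [CharZero K] {A : ℕ → R} {M : ℤ → R}
    (hA : ∀ i j, Commute (A i) (A j))
    (hM : ∀ n : ℕ, n ≠ 0 → ∀ b, (n • A n) * M b = M b * (n • A n) - M (b - n)) (n : ℕ) (b : ℤ) :
    coeff (n + 1) (expSeries K A) * M b =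
      M b * coeff (n + 1) (expSeries K A) - M (b - 1) * coeff n (expSeries K A) := by
  have h := congrArg (coeff (n + 1)) (expSeries_mul_C (K := K) hA hM b)
  rwa [coeff_mul_C, sub_mul, map_sub, coeff_C_mul, mul_assoc, coeff_succ_X_mul,
    coeff_C_mul] at h

end Exp

end PowerSeries

open PowerSeries in
theorem coeff_expSeries_eq_expCoeff (A : ℕ → Module.End F SF) (n : ℕ) :
    coeff n (expSeries F A) = expCoeff A n := coeff_mk _ _

open PowerSeries in
theorem coeff_expSeries_eq_expGF (a : ℕ → SF) (n : ℕ) :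
    coeff n (expSeries F a) = expGF a n := coeff_mk _ _

theorem one_sub_q_pow_ne_zero_s5 {k : ℕ} (hk : k ≠ 0) : 1 - q ^ k ≠ 0 := by
  intro h
  have h1 : (1 : MvPolynomial (Fin 2) ℚ) - MvPolynomial.X 0 ^ k = 0 := by
    apply IsFractionRing.injective (MvPolynomial (Fin 2) ℚ) F
    simpa [q] using h
  have h2 := congrArg (MvPolynomial.eval 0) h1
  simp [hk] at h2

theorem pd_pnat (i : ℕ+) (f : SF) : pd i f = MvPolynomial.pderiv i f :=
  LinearMap.congr_fun (dif_pos i.pos : pd i = (MvPolynomial.pderiv i).toLinearMap) f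

theorem pvar_pnat (i : ℕ+) : pvar i = MvPolynomial.X i := dif_pos i.pos

theorem pd_mul (k : ℕ) (f g : SF) : pd k (f * g) = pd k f * g + f * pd k g := by
  rcases k.eq_zero_or_pos with rfl | hk
  · simp [pd_zero]
  · lift k to ℕ+ using hk
    simp only [pd_pnat, MvPolynomial.pderiv_mul]

theorem pd_one (k : ℕ) : pd k 1 = 0 := by
  rcases k.eq_zero_or_pos with rfl | hk
  · simp [pd_zero]
  · lift k to ℕ+ using hk
    rw [pd_pnat, MvPolynomial.pderiv_one]

theorem pd_pvar {k n : ℕ} (hk : k ≠ 0) (hn : n ≠ 0) : pd k (pvar n) = if n = k then 1 else 0 := by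
  lift k to ℕ+ using Nat.pos_of_ne_zero hk
  lift n to ℕ+ using Nat.pos_of_ne_zero hn
  rw [pd_pnat, pvar_pnat]
  split_ifs with h
  · rw [PNat.coe_injective h, MvPolynomial.pderiv_X_self]
  · exact MvPolynomial.pderiv_X_of_ne fun h' => h (congrArg PNat.val h')

theorem commute_pd (i j : ℕ) : Commute (pd i) (pd j) := by
  rcases i.eq_zero_or_pos with rfl | hi
  · simp [pd_zero]
  rcases j.eq_zero_or_pos with rfl | hj
  · simp [pd_zero]
  lift i to ℕ+ using hi
  lift j to ℕ+ using hj
  refine LinearMap.ext fun f => ?_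
  simp only [Module.End.mul_apply, pd_pnat]
  ext d
  simp only [MvPolynomial.coeff_pderiv]
  rw [add_right_comm, Finsupp.add_apply, Finsupp.add_apply, Finsupp.single_apply,
    Finsupp.single_apply]
  split_ifs with h1 h2 h2
  · rw [h1]
  · exact absurd h1.symm h2
  · exact absurd h2.symm h1
  · push_cast
    ring

/-- `∂v^{(∞)}_b/∂p_k = v^{(∞)}_{b-k}/(k(1-q^k))`. -/
theorem pd_vInf {k : ℕ} (hk : k ≠ 0) (b : ℕ) :
    pd k (vInf b) = ((k : F) * (1 - q ^ k))⁻¹ • vInfZ ((b : ℤ) - k) := by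
  set a : ℕ → SF := fun m => ((m : F) * (1 - q ^ m))⁻¹ • pvar m with ha
  set V := PowerSeries.expSeries F a with hV
  set W : PowerSeries SF := PowerSeries.mk fun n => pd k (PowerSeries.coeff n V) with hW
  set B := PowerSeries.euler (PowerSeries.positivePart a) with hB
  set c : SF := MvPolynomial.C ((k : F) * (1 - q ^ k))⁻¹ with hc
  set Y := PowerSeries.C c * PowerSeries.X ^ k * V with hY
  have hVB : PowerSeries.euler V = B * V := PowerSeries.euler_expSeries fun i j => Commute.all _ _
  have hdB : ∀ n, pd k (PowerSeries.coeff n B) =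
      PowerSeries.coeff n (k • (PowerSeries.C c * PowerSeries.X ^ k)) := by
    intro n
    rw [hB, PowerSeries.coeff_euler, PowerSeries.positivePart, PowerSeries.coeff_mk, map_nsmul,
      map_nsmul, PowerSeries.coeff_C_mul, PowerSeries.coeff_X_pow]
    split_ifs with h1 h2 h2
    · omega
    · simp
    · subst h2
      rw [ha, map_smul, pd_pvar h1 h1, if_pos rfl, mul_one, hc, MvPolynomial.smul_eq_C_mul, mul_one]
    · rw [ha, map_smul, pd_pvar hk h1, if_neg h2]
      simp
  have hWD : PowerSeries.euler W = B * W + k • Y := by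
    have : PowerSeries.euler W = PowerSeries.mk fun n => pd k (PowerSeries.coeff n (B * V)) := by
      ext1 n
      rw [PowerSeries.coeff_euler, hW, PowerSeries.coeff_mk, PowerSeries.coeff_mk, ← hVB,
        PowerSeries.coeff_euler, map_nsmul]
    rw [this, hY, ← smul_mul_assoc, add_comm]
    ext1 n
    rw [PowerSeries.coeff_mk, map_add, PowerSeries.coeff_mul, PowerSeries.coeff_mul,
      PowerSeries.coeff_mul, map_sum, ← Finset.sum_add_distrib]
    refine Finset.sum_congr rfl fun p _ => ?_
    rw [pd_mul, hdB, hW, PowerSeries.coeff_mk]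
  have hXk : ∀ j : ℕ, PowerSeries.euler (PowerSeries.X ^ j : PowerSeries SF)
      = j • PowerSeries.X ^ j := by
    intro j
    ext1 n
    rw [PowerSeries.coeff_euler, map_nsmul, PowerSeries.coeff_X_pow]
    split_ifs with h <;> simp [h]
  have hYD : PowerSeries.euler Y = B * Y + k • Y := by
    rw [hY, PowerSeries.euler_mul, PowerSeries.euler_mul, PowerSeries.euler_C, hXk, hVB]
    simp only [nsmul_eq_mul]
    ring
  have hsub : PowerSeries.euler (W - Y) = B * (W - Y) := by
    rw [PowerSeries.euler_sub, hWD, hYD]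
    ring
  have hWY : W - Y = 0 := by
    refine PowerSeries.eq_of_euler_eq_mul F (B := B) ?_ hsub ?_ ?_
    · rw [hB, PowerSeries.coeff_euler, zero_smul]
    · ext1 n
      simp [PowerSeries.coeff_euler]
    · rw [map_sub, hW, PowerSeries.coeff_mk, hV, PowerSeries.coeff_zero_expSeries, pd_one, hY,
        mul_assoc, PowerSeries.coeff_C_mul, PowerSeries.coeff_X_pow_mul']
      simp [hk]
  have := congrArg (PowerSeries.coeff b) (sub_eq_zero.mp hWY)
  rw [hW, PowerSeries.coeff_mk, hV, coeff_expSeries_eq_expGF] at this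
  change pd k (vInf b) = _ at this
  rw [this, hY, mul_assoc, PowerSeries.coeff_C_mul, PowerSeries.coeff_X_pow_mul', hc,
    ← MvPolynomial.smul_eq_C_mul, vInfZ]
  congr 1
  split_ifs with h1 h2 h2
  · rw [hV, coeff_expSeries_eq_expGF, vInf, show ((b : ℤ) - k).toNat = b - k by omega]
  · omega
  · omega
  · rfl

theorem vInfZ_natCast (b : ℕ) : vInfZ b = vInf b := if_pos (Int.natCast_nonneg b)

theorem pd_vInfZ {k : ℕ} (hk : k ≠ 0) (b : ℤ) :
    pd k (vInfZ b) = ((k : F) * (1 - q ^ k))⁻¹ • vInfZ (b - k) := by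
  by_cases h : 0 ≤ b
  · obtain ⟨b, rfl⟩ := Int.eq_ofNat_of_zero_le h
    rw [← pd_vInf hk]
    simp [vInfZ]
  · rw [vInfZ, vInfZ, if_neg h, if_neg (by omega)]
    simp

theorem pd_mul_mulLeft_vInfZ {n : ℕ} (hn : n ≠ 0) (b : ℤ) :
    (n • (-(1 - q ^ n)) • pd n) * LinearMap.mulLeft F (vInfZ b) =
      LinearMap.mulLeft F (vInfZ b) * (n • (-(1 - q ^ n)) • pd n) -
        LinearMap.mulLeft F (vInfZ (b - n)) := by
  refine LinearMap.ext fun f => ?_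
  have hn' : (n : F) ≠ 0 := Nat.cast_ne_zero.mpr hn
  have hq := one_sub_q_pow_ne_zero_s5 hn
  simp only [Module.End.mul_apply, LinearMap.sub_apply, LinearMap.smul_apply,
    LinearMap.mulLeft_apply, pd_mul, pd_vInfZ hn, smul_add, mul_smul_comm, smul_mul_assoc,
    ← Nat.cast_smul_eq_nsmul F, smul_smul]
  rw [show (n : F) * -(1 - q ^ n) * ((n : F) * (1 - q ^ n))⁻¹ = -1 by field_simp, neg_one_smul]
  abel

theorem Nminus_zero_vInf_mul (b : ℕ) (g : SF) :
    Nminus 0 (vInf b * g) = vInf b * Nminus 0 g := by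
  have h : Nminus 0 = 1 :=
    (coeff_expSeries_eq_expCoeff _ _).symm.trans (PowerSeries.coeff_zero_expSeries _)
  rw [h, Module.End.one_apply, Module.End.one_apply]

theorem Nminus_succ_vInf_mul (n b : ℕ) (g : SF) :
    Nminus (n + 1) (vInf b * g) =
      vInf b * Nminus (n + 1) g - vInfZ ((b : ℤ) - 1) * Nminus n g := by
  have h := PowerSeries.coeff_succ_expSeries_mul (K := F)
    (A := fun n => (-(1 - q ^ n)) • pd n) (M := fun b => LinearMap.mulLeft F (vInfZ b))
    (fun i j => ((commute_pd i j).smul_left _).smul_right _)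
    (fun n hn b => pd_mul_mulLeft_vInfZ hn b) n b
  rw [coeff_expSeries_eq_expCoeff, coeff_expSeries_eq_expCoeff] at h
  rw [← vInfZ_natCast]
  exact LinearMap.congr_fun h g

/-- The polynomials of weighted degree less than `m`. -/
def degreeLT (m : ℕ) : Submodule F SF where
  carrier := {f | ∀ d, MvPolynomial.coeff d f ≠ 0 → Finsupp.weight (fun n : ℕ+ => (n : ℕ)) d < m}
  zero_mem' := by simp
  add_mem' {f g} hf hg d hd := by
    by_cases h : MvPolynomial.coeff d f = 0
    · exact hg d (by simpa [h] using hd)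
    · exact hf d h
  smul_mem' c f hf d hd := hf d fun h => hd (by simp [h])

theorem pd_mem_degreeLT (k : ℕ) {m : ℕ} {f : SF} (hf : f ∈ degreeLT m) :
    pd k f ∈ degreeLT (m - k) := by
  rcases k.eq_zero_or_pos with rfl | hk
  · simp [pd_zero]
  lift k to ℕ+ using hk
  intro d hd
  rw [pd_pnat, MvPolynomial.coeff_pderiv] at hd
  have := hf _ (left_ne_zero_of_mul hd)
  rw [map_add, Finsupp.weight_single, one_smul] at this
  omega

theorem Nminus_eq_zero {n : ℕ} {f : SF} (hf : wdeg f < n) : Nminus n f = 0 := by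
  have hfn : f ∈ degreeLT n := fun d hd =>
    (MvPolynomial.le_weightedTotalDegree _ (MvPolynomial.mem_support_iff.mpr hd)).trans_lt hf
  have hprod (l : List ℕ) :
      (l.map fun n => (-(1 - q ^ n)) • pd n).prod f ∈ degreeLT (n - l.sum) := by
    induction l with
    | nil => simpa using hfn
    | cons k l ih =>
      rw [List.map_cons, List.prod_cons, List.sum_cons, add_comm k, ← Nat.sub_sub]
      exact Submodule.smul_mem _ _ (pd_mem_degreeLT k ih)
  rw [Nminus, expCoeff, LinearMap.sum_apply]
  refine Finset.sum_eq_zero fun c _ => ?_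
  have h := hprod c.blocks
  rw [c.blocks_sum, Nat.sub_self] at h
  have h0 : (c.blocks.map fun n => (-(1 - q ^ n)) • pd n).prod f = 0 := by
    ext d
    by_contra hd
    exact Nat.not_lt_zero _ (h d hd)
  rw [LinearMap.smul_apply, h0, smul_zero]

theorem Pplus_mul (n : ℕ) (f g : SF) : Pplus n (f * g) = f * Pplus n g := by
  have hprod (l : List ℕ) :
      (l.map fun n : ℕ => ((1 - t⁻¹ ^ n) / (n : F)) • mulP n).prod (f * g) =
        f * (l.map fun n : ℕ => ((1 - t⁻¹ ^ n) / (n : F)) • mulP n).prod g := by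
    induction l with
    | nil => simp
    | cons k l ih =>
      rw [List.map_cons, List.prod_cons, Module.End.mul_apply, ih, Module.End.mul_apply,
        LinearMap.smul_apply, LinearMap.smul_apply, mulP, LinearMap.mulLeft_apply,
        LinearMap.mulLeft_apply, mul_left_comm, mul_smul_comm]
  simp only [Pplus, expCoeff, LinearMap.sum_apply, LinearMap.smul_apply, hprod, Finset.mul_sum,
    mul_smul_comm]

theorem eta_eq_sum_range (d : ℤ) {f : SF} {M : ℕ} (hM : wdeg f < M) :
    eta d f = ∑ b ∈ Finset.range M,
      if d ≤ (b : ℤ) then Pplus ((b : ℤ) - d).toNat (Nminus b f) else 0 := by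
  refine Finset.sum_subset (Finset.range_subset_range.mpr hM) fun b _ hb => ?_
  rw [Nminus_eq_zero (by simpa [Nat.lt_succ_iff] using hb), map_zero, ite_self]

/-- For all integers `a ∈ ℤ`, `b ≥ 0` and every `g ∈ Λ_F`:
`η_a (v^{(∞)}_b ⬝ g) = v^{(∞)}_b ⬝ (η_a g) − v^{(∞)}_{b-1} ⬝ (η_{a-1} g)`,
with the convention `v^{(∞)}_{-1} = 0`. -/
theorem stmt5 (a : ℤ) (b : ℕ) (g : SF) :
    eta a (vInf b * g) =
      vInf b * eta a g - vInfZ ((b : ℤ) - 1) * eta (a - 1) g := by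
  obtain ⟨M, hM, hM'⟩ : ∃ M, wdeg (vInf b * g) < M ∧ wdeg g < M :=
    ⟨max (wdeg (vInf b * g)) (wdeg g) + 1, by omega, by omega⟩
  rw [eta_eq_sum_range a (hM.trans M.lt_succ_self), eta_eq_sum_range a (hM'.trans M.lt_succ_self),
    eta_eq_sum_range (a - 1) hM', Finset.sum_range_succ', Finset.sum_range_succ', mul_add,
    Nminus_zero_vInf_mul, Finset.mul_sum, Finset.mul_sum, add_sub_right_comm,
    ← Finset.sum_sub_distrib, mul_ite, mul_zero, Pplus_mul]
  congr 1
  refine Finset.sum_congr rfl fun n _ => ?_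
  rw [Nminus_succ_vInf_mul, map_sub, Pplus_mul, Pplus_mul]
  by_cases h : a ≤ ((n + 1 : ℕ) : ℤ)
  · rw [if_pos h, if_pos h, if_pos (by push_cast at h; omega)]
    rw [show (n : ℤ) - (a - 1) = ((n + 1 : ℕ) : ℤ) - a by push_cast; ring]
  · rw [if_neg h, if_neg h, if_neg (by push_cast at h; omega)]
    simp
end
end

section
/- Let μ be a partition with m corners, and let s₁, …, s_{m+1} be its addable boxes labelled from right to left; write α_k := i(s_k) − 1, β_k := j(s_k) − 1, and set X_k := q^{β_k} t^{−α_k} (1 ≤ k ≤ m+1) and Y_k := q^{β_k} t^{−α_{k+1}} (1 ≤ k ≤ m). Then Σ_{n=1}^{m} Y_n − Σ_{n=1}^{m+1} X_n = (1−q)(1−t^{−1}) Σ_{s∈μ} B_s − 1, as an identity in F = ℚ(q,t). -/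
noncomputable section
open scoped BigOperators
set_option maxHeartbeats 1000000
set_option synthInstance.maxHeartbeats 400000
attribute [local instance] Classical.propDecidable

/-- The row lengths of a partition, `0`-indexed: `rows p i = λ_{i+1}`. -/
def rows {n : ℕ} (p : Nat.Partition n) : ℕ → ℕ :=
  fun i => ((p.parts.sort (· ≤ ·)).reverse).getD i 0

/-- The Young diagram of a row-length function `r`, as a finset of `0`-indexed boxes
`(i,j)` (`i` the row, `j` the column, so the `1`-indexed coordinates are `(i+1, j+1)`);
`N` is any bound exceeding all row indices and row lengths. -/
def cellsR (N : ℕ) (r : ℕ → ℕ) : Finset (ℕ × ℕ) :=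
  (Finset.range N ×ˢ Finset.range N).filter fun s => s.2 < r s.1

/-- The conjugate partition: `conjR N r j` is the length of the `0`-indexed column `j`. -/
def conjR (N : ℕ) (r : ℕ → ℕ) (j : ℕ) : ℕ :=
  ((Finset.range N).filter fun i => j < r i).card

/-- The arm length `a(s) = λ_i − j` of a (`0`-indexed) box `s`. -/
def armR (r : ℕ → ℕ) (s : ℕ × ℕ) : ℤ := (r s.1 : ℤ) - s.2 - 1

/-- The leg length `l(s) = λ'_j − i` of a (`0`-indexed) box `s`. -/
def legR (N : ℕ) (r : ℕ → ℕ) (s : ℕ × ℕ) : ℤ := (conjR N r s.2 : ℤ) - s.1 - 1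

/-- `B_s = q^{j-1} t^{1-i}` for a (`0`-indexed) box `s`. -/
def Bbox (s : ℕ × ℕ) : F := q ^ (s.2 : ℤ) * t ^ (-(s.1 : ℤ))

/-- The factor `c_λ(s;q,t) = 1 − q^{a(s)} t^{l(s)+1}`. -/
def cArm (N : ℕ) (r : ℕ → ℕ) (s : ℕ × ℕ) : F :=
  1 - q ^ armR r s * t ^ (legR N r s + 1)

/-- The factor `c'_λ(s;q,t) = 1 − q^{a(s)+1} t^{l(s)}`. -/
def cArm' (N : ℕ) (r : ℕ → ℕ) (s : ℕ × ℕ) : F :=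
  1 - q ^ (armR r s + 1) * t ^ legR N r s

/-- `c_λ(q,t) = ∏_{s∈λ} (1 − q^{a(s)} t^{l(s)+1})`. -/
def cfun (N : ℕ) (r : ℕ → ℕ) : F := ∏ s ∈ cellsR N r, cArm N r s

/-- `c'_λ(q,t) = ∏_{s∈λ} (1 − q^{a(s)+1} t^{l(s)})`. -/
def cfun' (N : ℕ) (r : ℕ → ℕ) : F := ∏ s ∈ cellsR N r, cArm' N r s

/-- `b_λ(s;q,t) = c_λ(s)/c'_λ(s)` for `s ∈ λ`, and `1` otherwise. -/
def bval (N : ℕ) (r : ℕ → ℕ) (s : ℕ × ℕ) : F :=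
  if s ∈ cellsR N r then cArm N r s / cArm' N r s else 1

/-- `ψ'_{λ/μ}(q,t) = ∏_s b_λ(s)/b_μ(s)`, the product over boxes lying in a column that
meets `λ/μ` but not in a row that meets `λ/μ` (boxes outside `λ` contribute `1`). -/
def psiP (N : ℕ) (rl rm : ℕ → ℕ) : F :=
  ∏ s ∈ (cellsR N rl).filter (fun s =>
      (∃ i, (i, s.2) ∈ cellsR N rl ∧ (i, s.2) ∉ cellsR N rm) ∧
      ¬ (∃ j, (s.1, j) ∈ cellsR N rl ∧ (s.1, j) ∉ cellsR N rm)),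
    bval N rl s / bval N rm s

/-- The Pieri coefficient `d_{λ/μ}(q,t) = ψ'_{λ/μ}(q,t) ⬝ c_μ(q,t)/c'_λ(q,t)`. -/
def dcoef (N : ℕ) (rl rm : ℕ → ℕ) : F := psiP N rl rm * cfun N rm / cfun' N rl

/-- The Pieri coefficient
`c_{λ/μ}(q,t) = ψ'_{λ/μ}(q,t) ⬝ (c'_λ(q,t)/c'_μ(q,t)) ⬝ (1−t)/(1−q)`. -/
def ccoef (N : ℕ) (rl rm : ℕ → ℕ) : F :=
  psiP N rl rm * (cfun' N rl / cfun' N rm) * ((1 - t) / (1 - q))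

/-- `n(λ) = ∑_{s∈λ} (i(s)−1)`. -/
def nstat (N : ℕ) (r : ℕ → ℕ) : ℕ := ∑ s ∈ cellsR N r, s.1

/-- `n(λ') = ∑_{s∈λ} (j(s)−1)`. -/
def nstatC (N : ℕ) (r : ℕ → ℕ) : ℕ := ∑ s ∈ cellsR N r, s.2

/-- A (`0`-indexed) box `b` is addable for the diagram of `r` if `b` is not in the
diagram but adding it yields a Young diagram. -/
def addableBox (N : ℕ) (r : ℕ → ℕ) (b : ℕ × ℕ) : Prop :=
  b ∉ cellsR N r ∧ (b.1 = 0 ∨ (b.1 - 1, b.2) ∈ cellsR N r) ∧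
    (b.2 = 0 ∨ (b.1, b.2 - 1) ∈ cellsR N r)

theorem rows_eq_zero {n : ℕ} (μ : Nat.Partition n) : rows μ n = 0 := by
  have hcard : μ.parts.card ≤ n := by
    have h := Multiset.card_nsmul_le_sum (s := μ.parts) (a := 1) fun x hx => μ.parts_pos hx
    simpa [μ.parts_sum] using h
  apply List.getD_eq_default
  simpa using hcard

theorem rows_le {n : ℕ} (μ : Nat.Partition n) (i : ℕ) : rows μ i ≤ n := by
  unfold rows
  rcases lt_or_ge i (μ.parts.sort (· ≤ ·)).reverse.length with h | h
  · rw [List.getD_eq_getElem _ _ h]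
    refine μ.le_of_mem_parts ?_
    have := List.getElem_mem h
    simpa only [List.mem_reverse, Multiset.mem_sort] using this
  · rw [List.getD_eq_default _ _ h]
    exact Nat.zero_le n

theorem antitone_rows {n : ℕ} (μ : Nat.Partition n) : Antitone (rows μ) := by
  intro i j hij
  unfold rows
  rcases lt_or_ge j (μ.parts.sort (· ≤ ·)).reverse.length with h | h
  · rw [List.getD_eq_getElem _ _ h, List.getD_eq_getElem _ _ (hij.trans_lt h)]
    have hs : (μ.parts.sort (· ≤ ·)).reverse.Pairwise (· ≥ ·) :=
      List.pairwise_reverse.2 (μ.parts.pairwise_sort (· ≤ ·))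
    rcases hij.eq_or_lt with rfl | hlt
    · exact le_rfl
    · exact List.pairwise_iff_getElem.1 hs i j _ h hlt
  · rw [List.getD_eq_default _ _ h]
    exact Nat.zero_le _

theorem mem_cellsR_rows {n : ℕ} (μ : Nat.Partition n) (b : ℕ × ℕ) :
    b ∈ cellsR n (rows μ) ↔ b.2 < rows μ b.1 := by
  simp only [cellsR, Finset.mem_filter, Finset.mem_product, Finset.mem_range,
    and_iff_right_iff_imp]
  intro h
  refine ⟨?_, h.trans_le (rows_le μ _)⟩
  by_contra! hn
  have := antitone_rows μ hn
  rw [rows_eq_zero] at this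
  omega

theorem addableBox_rows_iff {n : ℕ} (μ : Nat.Partition n) (b : ℕ × ℕ) :
    addableBox n (rows μ) b ↔
      b.2 = rows μ b.1 ∧ (b.1 = 0 ∨ rows μ b.1 < rows μ (b.1 - 1)) := by
  simp only [addableBox, mem_cellsR_rows]
  constructor
  · rintro ⟨h1, h2, h3⟩
    have h : b.2 = rows μ b.1 := by omega
    exact ⟨h, by rwa [h] at h2⟩
  · rintro ⟨h, h2⟩
    rw [h]
    omega

/-- The generating function of the cells, summed row by row and then by parts. -/
theorem one_sub_mul_sum_cellsR {K : Type*} [Field K] (x y : K) (N : ℕ) (r : ℕ → ℕ)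
    (hr : ∀ i, r i ≤ N) (h0 : r N = 0) :
    (1 - x) * (1 - y) * (∑ b ∈ cellsR N r, x ^ b.2 * y ^ b.1) =
      1 - x ^ r 0 + ∑ i ∈ Finset.range N, (x ^ r i - x ^ r (i + 1)) * y ^ (i + 1) := by
  have hrow (i : ℕ) : (1 - x) * (∑ j ∈ Finset.range N with j < r i, x ^ j * y ^ i) =
      (1 - x ^ r i) * y ^ i := by
    have hset : (Finset.range N).filter (fun j => j < r i) = Finset.range (r i) := by
      ext j
      have := hr i
      simp only [Finset.mem_filter, Finset.mem_range]
      omega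
    rw [hset, ← Finset.sum_mul, ← mul_assoc, mul_neg_geom_sum]
  have hcells : (1 - x) * (∑ b ∈ cellsR N r, x ^ b.2 * y ^ b.1) =
      ∑ i ∈ Finset.range N, (1 - x ^ r i) * y ^ i := by
    rw [cellsR, Finset.sum_filter, Finset.sum_product, Finset.mul_sum]
    refine Finset.sum_congr rfl fun i _ => ?_
    rw [← hrow, Finset.sum_filter]
  have hparts (M : ℕ) : (1 - y) * (∑ i ∈ Finset.range M, (1 - x ^ r i) * y ^ i) =
      1 - x ^ r 0 + (∑ i ∈ Finset.range M, (x ^ r i - x ^ r (i + 1)) * y ^ (i + 1)) -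
        (1 - x ^ r M) * y ^ M := by
    induction M with
    | zero => simp
    | succ M ih =>
      rw [Finset.sum_range_succ, Finset.sum_range_succ, mul_add, ih]
      ring
  rw [mul_right_comm, hcells, mul_comm, hparts, h0]
  simp

/-- Between consecutive descents of an antitone function, the function is constant. -/
theorem antitone_pred_eq_of_descents {r : ℕ → ℕ} (hr : Antitone r) {m : ℕ}
    {a : Fin (m + 1) → ℕ} (ha : StrictMono a)
    (hall : ∀ i, (i = 0 ∨ r i < r (i - 1)) → ∃ k, a k = i) (j : Fin m) :
    r (a j.succ - 1) = r (a j.castSucc) := by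
  have hlt : a j.castSucc < a j.succ := ha j.castSucc_lt_succ
  refine le_antisymm (hr (by omega)) ?_
  have hex : ∃ i, r i = r (a j.succ - 1) := ⟨_, rfl⟩
  have hmin : Nat.find hex ≤ a j.succ - 1 := Nat.find_min' hex rfl
  have hspec := Nat.find_spec hex
  obtain ⟨k, hk⟩ := hall (Nat.find hex) <| by
    by_contra! hcon
    have heq := le_antisymm hcon.2 (hr (Nat.sub_le _ 1))
    exact Nat.find_min hex (m := Nat.find hex - 1) (by omega) (heq.trans hspec)
  have hkj : k ≤ j.castSucc := by
    have : k < j.succ := ha.lt_iff_lt.1 (by omega)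
    exact Fin.le_castSucc_iff.2 this
  rw [← hspec, ← hk]
  exact hr (ha.monotone hkj)

/-- Let `μ` be a partition with `m` corners and addable boxes `s 0, …, s m` labelled from
right to left; write `α_k = i(s_k)−1`, `β_k = j(s_k)−1`, and set `X_k = q^{β_k} t^{−α_k}`
(`1 ≤ k ≤ m+1`) and `Y_k = q^{β_k} t^{−α_{k+1}}` (`1 ≤ k ≤ m`). Then
`∑_{n=1}^{m} Y_n − ∑_{n=1}^{m+1} X_n = (1−q)(1−t⁻¹) ∑_{s∈μ} B_s − 1`. -/
theorem stmt8 (n : ℕ) (μ : Nat.Partition n) (m : ℕ) (s : Fin (m + 1) → ℕ × ℕ)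
    (hadd : ∀ k, addableBox n (rows μ) (s k))
    (hord : ∀ k l : Fin (m + 1), k < l → (s l).2 < (s k).2)
    (hall : ∀ b : ℕ × ℕ, addableBox n (rows μ) b → ∃ k, s k = b) :
    (∑ j : Fin m, q ^ ((s j.castSucc).2 : ℤ) * t ^ (-((s j.succ).1 : ℤ))) -
      (∑ k : Fin (m + 1), q ^ ((s k).2 : ℤ) * t ^ (-((s k).1 : ℤ)))
    = (1 - q) * (1 - t⁻¹) * (∑ b ∈ cellsR n (rows μ), Bbox b) - 1 := by
  set r := rows μ
  have hanti : Antitone r := antitone_rows μ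
  have hs2 (k) : (s k).2 = r (s k).1 := ((addableBox_rows_iff μ _).1 (hadd k)).1
  have hdesc (k) : (s k).1 = 0 ∨ r (s k).1 < r ((s k).1 - 1) :=
    ((addableBox_rows_iff μ _).1 (hadd k)).2
  have ha : StrictMono fun k => (s k).1 := by
    intro k l hkl
    have h := hord k l hkl
    rw [hs2, hs2] at h
    exact hanti.reflect_lt h
  have hsurj (i : ℕ) (hi : i = 0 ∨ r i < r (i - 1)) : ∃ k, (s k).1 = i := by
    obtain ⟨k, hk⟩ := hall (i, r i) ((addableBox_rows_iff μ _).2 ⟨rfl, hi⟩)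
    exact ⟨k, by rw [hk]⟩
  have hzero : (s 0).1 = 0 := by
    obtain ⟨k, hk⟩ := hsurj 0 (Or.inl rfl)
    have := ha.monotone (Fin.zero_le k)
    omega
  have hpos (j : Fin m) : 0 < (s j.succ).1 := by
    have := ha j.succ_pos
    simp only at this
    omega
  have hpred (j : Fin m) : r ((s j.succ).1 - 1) = r (s j.castSucc).1 :=
    antitone_pred_eq_of_descents hanti ha hsurj j
  have hsum : ∑ j : Fin m, (q ^ r (s j.castSucc).1 - q ^ r (s j.succ).1) * t⁻¹ ^ (s j.succ).1 =
      ∑ i ∈ Finset.range n, (q ^ r i - q ^ r (i + 1)) * t⁻¹ ^ (i + 1) := by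
    refine Finset.sum_of_injOn (fun j : Fin m => (s j.succ).1 - 1) ?_ ?_ ?_ ?_
    · intro j _ l _ hjl
      have hj := hpos j
      have hl := hpos l
      simp only at hjl
      exact Fin.succ_injective m (ha.injective (show (s j.succ).1 = (s l.succ).1 by omega))
    · intro j _
      have hj := hpos j
      have hd := hdesc j.succ
      simp only [Finset.coe_range, Set.mem_Iio]
      by_contra! hn
      have hle : r ((s j.succ).1 - 1) ≤ 0 := (hanti hn).trans_eq (rows_eq_zero μ)
      omega
    · intro i _ hi
      have hle : r i ≤ r (i + 1) := by
        by_contra! hlt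
        obtain ⟨k, hk⟩ := hsurj (i + 1) (Or.inr hlt)
        obtain ⟨j, rfl⟩ := Fin.exists_succ_eq.2 (show k ≠ 0 by rintro rfl; omega)
        exact hi ⟨j, by simp, by simp [hk]⟩
      rw [le_antisymm hle (hanti i.le_succ), sub_self, zero_mul]
    · intro j _
      rw [hpred, Nat.sub_add_cancel (hpos j)]
  have hB : ∑ b ∈ cellsR n r, Bbox b = ∑ b ∈ cellsR n r, q ^ b.2 * t⁻¹ ^ b.1 :=
    Finset.sum_congr rfl fun b _ => by
      rw [Bbox, zpow_natCast, zpow_neg, zpow_natCast, inv_pow]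
  rw [hB, one_sub_mul_sum_cellsR q t⁻¹ n r (rows_le μ) (rows_eq_zero μ), ← hsum,
    Fin.sum_univ_succ]
  simp only [hs2, hzero, zpow_neg, zpow_natCast, inv_pow, sub_mul, Finset.sum_sub_distrib,
    pow_zero, inv_one, mul_one]
  ring
end
end

section
/- For every integer n ≥ 0: Σ_{λ⊢n} t^{2n(λ)} / (c_λ(q,t) · c'_λ(q,t)) = Σ_{μ⊢n} 1/(z_μ · Π_i (1−q^{μ_i})(1−t^{μ_i})), where the left sum is over all partitions λ of n and the right sum over all partitions μ of n. Equivalently, Σ_λ w^{|λ|} t^{2n(λ)}/(c_λ(q,t) c'_λ(q,t)) = exp(Σ_{m>0} w^m/(m(1−q^m)(1−t^m))) as formal power series in w over ℚ(q,t). -/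
noncomputable section
open scoped BigOperators
set_option maxHeartbeats 1000000
set_option synthInstance.maxHeartbeats 400000
attribute [local instance] Classical.propDecidable

/-- `z_μ = ∏_j j^{m_j(μ)} m_j(μ)!`, where `m_j(μ)` is the multiplicity of `j` in `μ`. -/
def zmu {n : ℕ} (μ : Nat.Partition n) : F :=
  ((∏ j ∈ μ.parts.toFinset, j ^ μ.parts.count j * (μ.parts.count j).factorial : ℕ) : F)

namespace MacdonaldSum

open Finset PowerSeries

/-- The factor `z_μ`, as a function of the multiset of parts. -/
def zMul (s : Multiset ℕ) : ℕ := ∏ j ∈ s.toFinset, j ^ s.count j * (s.count j).factorial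

theorem zMul_cons (m : ℕ) (s : Multiset ℕ) :
    zMul (m ::ₘ s) = m * (s.count m + 1) * zMul s := by
  have h1 : ∀ s : Multiset ℕ, ∀ S : Finset ℕ, s.toFinset ⊆ S →
      zMul s = ∏ j ∈ S, j ^ s.count j * (s.count j).factorial := by
    intro s S hS
    refine prod_subset hS fun j _ hj => ?_
    have : s.count j = 0 := Multiset.count_eq_zero_of_notMem (by simpa using hj)
    simp [this]
  have hm : m ∈ insert m s.toFinset := mem_insert_self _ _
  rw [h1 (m ::ₘ s) (insert m s.toFinset) (by simp), h1 s (insert m s.toFinset) (subset_insert _ _),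
    ← mul_prod_erase _ _ hm, ← mul_prod_erase _ _ hm, ← mul_assoc]
  congr 1
  · rw [Multiset.count_cons_self, Nat.factorial_succ, pow_succ]
    ring
  · refine prod_congr rfl fun j hj => ?_
    rw [Multiset.count_cons_of_ne (ne_of_mem_erase hj)]

/-- The complete homogeneous symmetric function of degree `n` in terms of power sums `g m`. -/
def hSum {K : Type*} [Field K] (g : ℕ → K) (n : ℕ) : K :=
  ∑ μ : Nat.Partition n, (μ.parts.map g).prod / (zMul μ.parts : K)

theorem hSum_zero {K : Type*} [Field K] (g : ℕ → K) : hSum g 0 = 1 := by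
  simp [hSum, zMul]

theorem zMul_ne_zero {s : Multiset ℕ} (hs : ∀ i ∈ s, 0 < i) : zMul s ≠ 0 := by
  refine prod_ne_zero_iff.2 fun j hj => ?_
  have := hs j (by simpa using hj)
  positivity

/-- Newton's identity `n hₙ = ∑ pₘ hₙ₋ₘ`. -/
theorem natCast_mul_hSum {K : Type*} [Field K] [CharZero K] (g : ℕ → K) (n : ℕ) :
    (n : K) * hSum g n = ∑ m ∈ range n, g (m + 1) * hSum g (n - (m + 1)) := by
  have hz : ∀ {k} (μ : Nat.Partition k), (zMul μ.parts : K) ≠ 0 := fun μ =>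
    Nat.cast_ne_zero.2 (zMul_ne_zero fun i hi => μ.parts_pos hi)
  have h1 : ∀ μ : Nat.Partition n, (n : K) * ((μ.parts.map g).prod / (zMul μ.parts : K))
      = ∑ m ∈ range n, if m + 1 ∈ μ.parts then
          ((m + 1 : ℕ) : K) * μ.parts.count (m + 1) * ((μ.parts.map g).prod / (zMul μ.parts : K))
          else 0 := by
    intro μ
    rw [← sum_filter, ← sum_mul]
    congr 1
    have h2 : n = ∑ j ∈ μ.parts.toFinset, μ.parts.count j * j := by
      conv_lhs => rw [← μ.parts_sum, sum_multiset_count]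
      simp
    conv_lhs => rw [h2]
    push_cast
    symm
    refine sum_bij (fun m _ => m + 1) (fun m hm => ?_) (fun a _ b _ h => by simpa using h)
      (fun j hj => ?_) (fun m _ => by push_cast; ring)
    · simpa using (mem_filter.1 hm).2
    · have hj' : j ∈ μ.parts := by simpa using hj
      have := μ.parts_pos hj'
      have hle : j ≤ n := by
        have := Multiset.le_sum_of_mem hj'
        rwa [μ.parts_sum] at this
      exact ⟨j - 1, mem_filter.2 ⟨mem_range.2 (by omega), by rwa [Nat.sub_add_cancel this]⟩,
        Nat.sub_add_cancel this⟩
  rw [hSum, mul_sum, sum_congr rfl fun μ _ => h1 μ, sum_comm]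
  refine sum_congr rfl fun m hm => ?_
  have hm' : m + 1 ≤ n := mem_range.1 hm
  rw [← sum_filter, hSum, mul_sum]
  symm
  refine sum_bij (fun ν _ => ⟨(m + 1) ::ₘ ν.parts, ?_, ?_⟩) (fun ν _ => ?_) (fun a _ b _ h => ?_)
    (fun μ hμ => ?_) (fun ν _ => ?_)
  · intro i hi
    rcases Multiset.mem_cons.1 hi with rfl | hi
    · exact Nat.succ_pos m
    · exact ν.parts_pos hi
  · rw [Multiset.sum_cons, ν.parts_sum]
    omega
  · simp
  · ext1
    simpa using congrArg Nat.Partition.parts h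
  · have hmem : m + 1 ∈ μ.parts := (mem_filter.1 hμ).2
    refine ⟨⟨μ.parts.erase (m + 1), fun hi => μ.parts_pos (Multiset.mem_of_mem_erase hi), ?_⟩,
      mem_univ _, ?_⟩
    · have h3 := Multiset.sum_cons (m + 1) (μ.parts.erase (m + 1))
      rw [Multiset.cons_erase hmem, μ.parts_sum] at h3
      omega
    · ext1
      simpa using Multiset.cons_erase hmem
  · have h4 := hz ν
    have h5 : ((m : K) + 1) ≠ 0 := by exact_mod_cast Nat.succ_ne_zero m
    have h6 : ((ν.parts.count (m + 1) : K) + 1) ≠ 0 :=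
      by exact_mod_cast Nat.succ_ne_zero (ν.parts.count (m + 1))
    simp only [Multiset.map_cons, Multiset.prod_cons, Multiset.count_cons_self, zMul_cons]
    push_cast
    field_simp

/-- The logarithmic-derivative equation `X f' = c f` has a unique solution up to scaling. -/
theorem powerSeries_eq_of_logDeriv {K : Type*} [Field K] [CharZero K] {c f g : K⟦X⟧}
    (hc : constantCoeff c = 0) (h0 : constantCoeff f = constantCoeff g)
    (hf : X * d⁄dX K f = c * f) (hg : X * d⁄dX K g = c * g) : f = g := by
  ext n
  induction n using Nat.strong_induction_on with
  | _ n ih =>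
    cases n with
    | zero => simpa using h0
    | succ n =>
      have hf' := congrArg (coeff (n + 1)) hf
      have hg' := congrArg (coeff (n + 1)) hg
      rw [coeff_succ_X_mul, coeff_derivative, coeff_mul] at hf' hg'
      have : coeff (n + 1) f * ((n : K) + 1) = coeff (n + 1) g * ((n : K) + 1) := by
        rw [hf', hg']
        refine sum_congr rfl fun x hx => ?_
        rcases Nat.eq_zero_or_pos x.1 with h | h
        · rw [h, coeff_zero_eq_constantCoeff_apply, hc, zero_mul, zero_mul]
        · rw [ih x.2 (by have := mem_antidiagonal.1 hx; omega)]
      exact mul_right_cancel₀ (by exact_mod_cast Nat.succ_ne_zero n) this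

theorem X_mul_derivative_mk_hSum {K : Type*} [Field K] [CharZero K] (g : ℕ → K) (h0 : g 0 = 0) :
    X * d⁄dX K (PowerSeries.mk (hSum g)) = PowerSeries.mk g * PowerSeries.mk (hSum g) := by
  ext n
  cases n with
  | zero => simp [h0]
  | succ n =>
    rw [coeff_succ_X_mul, coeff_derivative, coeff_mk, mul_comm]
    have := natCast_mul_hSum g (n + 1)
    push_cast at this
    rw [this, coeff_mul, Nat.sum_antidiagonal_eq_sum_range_succ
      (fun a b => coeff a (PowerSeries.mk g) * coeff b (PowerSeries.mk (hSum g))), sum_range_succ' _ (n + 1)]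
    simp [h0]

theorem X_mul_derivative_prod {K : Type*} [Field K] (a : ℕ → K) (N : ℕ) :
    X * d⁄dX K (∏ k ∈ range N, (1 - C (a k) * X : K⟦X⟧))
      = -PowerSeries.mk (fun m => if m = 0 then 0 else ∑ k ∈ range N, a k ^ m)
        * ∏ k ∈ range N, (1 - C (a k) * X : K⟦X⟧) := by
  induction N with
  | zero =>
    have : (PowerSeries.mk fun _ => (0 : K)) = 0 := by
      ext
      simp
    simp [this]
  | succ N ih =>
    have h1 : PowerSeries.mk (fun m => if m = 0 then 0 else ∑ k ∈ range (N + 1), a k ^ m)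
        = PowerSeries.mk (fun m => if m = 0 then 0 else ∑ k ∈ range N, a k ^ m)
          + PowerSeries.mk (fun m => if m = 0 then 0 else a N ^ m) := by
      ext m
      by_cases hm : m = 0 <;> simp [hm, sum_range_succ]
    have h2 : PowerSeries.mk (fun m => if m = 0 then 0 else a N ^ m) * (1 - C (a N) * X) = C (a N) * X := by
      ext m
      rw [mul_sub, mul_one, mul_left_comm, map_sub, coeff_C_mul, coeff_C_mul]
      cases m with
      | zero => simp
      | succ m =>
        rw [coeff_succ_mul_X, coeff_X]
        by_cases hm : m = 0
        · simp [hm]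
        · simp [hm, pow_succ, mul_comm]
    have h3 : d⁄dX K (1 - C (a N) * X : K⟦X⟧) = -C (a N) := by
      rw [map_sub, Derivation.leibniz, derivative_X, derivative_C]
      simp
    rw [prod_range_succ, Derivation.leibniz, h3, h1]
    simp only [smul_eq_mul]
    linear_combination (1 - C (a N) * X) * ih
      + (∏ k ∈ range N, (1 - C (a k) * X)) * h2

/-- The `q`-difference equation characterising `∑ hₙ Xⁿ` for the power sums
`pₘ = (1 - T^{Nm}) / ((1 - Q^m) (1 - T^m))`. -/
theorem eq_mk_hSum_of_prod_mul_eq_rescale {K : Type*} [Field K] [CharZero K] {Q T : K}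
    (hQ : ∀ m, m ≠ 0 → Q ^ m ≠ 1) (hT : ∀ m, m ≠ 0 → T ^ m ≠ 1) {N : ℕ} {f : K⟦X⟧}
    (h0 : constantCoeff f = 1)
    (hf : (∏ k ∈ range N, (1 - C (T ^ k) * X : K⟦X⟧)) * f = rescale Q f) :
    f = PowerSeries.mk (hSum fun m => (1 - (T ^ N) ^ m) / ((1 - Q ^ m) * (1 - T ^ m))) := by
  set g : ℕ → K := fun m => (1 - (T ^ N) ^ m) / ((1 - Q ^ m) * (1 - T ^ m)) with hg
  set P : K⟦X⟧ := ∏ k ∈ range N, (1 - C (T ^ k) * X : K⟦X⟧) with hP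
  have hP0 : constantCoeff P = 1 := by simp [hP]
  have hg0 : g 0 = 0 := by simp [hg]
  have key : P * PowerSeries.mk (hSum g) = rescale Q (PowerSeries.mk (hSum g)) := by
    refine powerSeries_eq_of_logDeriv (c := rescale Q (PowerSeries.mk g)) ?_ ?_ ?_ ?_
    · simp [← coeff_zero_eq_constantCoeff_apply, hg0]
    · simp [← coeff_zero_eq_constantCoeff_apply, hSum_zero, coeff_mul, hP0]
    · have h1 : rescale Q (PowerSeries.mk g) = PowerSeries.mk g
          - PowerSeries.mk (fun m => if m = 0 then 0 else ∑ k ∈ range N, (T ^ k) ^ m) := by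
        ext m
        rw [coeff_rescale, map_sub, coeff_mk, coeff_mk]
        by_cases hm : m = 0
        · simp [hm, hg0]
        · have e1 : 1 - Q ^ m ≠ 0 := sub_ne_zero.2 (hQ m hm).symm
          have e2 : 1 - T ^ m ≠ 0 := sub_ne_zero.2 (hT m hm).symm
          have e3 : (∑ k ∈ range N, (T ^ k) ^ m) * (1 - T ^ m) = 1 - (T ^ N) ^ m := by
            simp_rw [← pow_mul, mul_comm _ m, pow_mul]
            exact geom_sum_mul_neg _ _
          simp only [if_neg hm, hg]
          rw [← e3]
          field_simp
          ring
      have h2 := X_mul_derivative_prod (fun k => T ^ k) N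
      have h3 := X_mul_derivative_mk_hSum g hg0
      rw [← hP] at h2
      rw [Derivation.leibniz, h1]
      simp only [smul_eq_mul]
      linear_combination P * h3 + PowerSeries.mk (hSum g) * h2
    · rw [← map_mul, ← X_mul_derivative_mk_hSum g hg0]
      ext n
      cases n with
      | zero => simp
      | succ n =>
        rw [coeff_succ_X_mul, coeff_derivative, coeff_rescale, coeff_rescale, coeff_succ_X_mul,
          coeff_derivative]
        ring
  ext n
  induction n using Nat.strong_induction_on with
  | _ n ih =>
    by_cases hn : n = 0
    · subst hn
      simp [h0, hSum_zero]
    · have e1 := congrArg (coeff n) hf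
      have e2 := congrArg (coeff n) key
      rw [coeff_rescale, coeff_mul, ← add_sum_erase _ _
        (show (0, n) ∈ antidiagonal n by simp)] at e1 e2
      have e3 : ∑ x ∈ (antidiagonal n).erase (0, n), coeff x.1 P * coeff x.2 f
          = ∑ x ∈ (antidiagonal n).erase (0, n), coeff x.1 P * coeff x.2 (PowerSeries.mk (hSum g)) := by
        refine sum_congr rfl fun x hx => ?_
        obtain ⟨hx1, hx2⟩ := mem_erase.1 hx
        rw [HasAntidiagonal.mem_antidiagonal] at hx2
        have : x.2 < n := by
          rcases Nat.eq_zero_or_pos x.1 with h | h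
          · exact absurd (Prod.ext h (by simp only; omega)) hx1
          · omega
        rw [ih _ this]
      rw [e3] at e1
      simp only [coeff_zero_eq_constantCoeff_apply, hP0, one_mul] at e1 e2
      have e4 : 1 - Q ^ n ≠ 0 := sub_ne_zero.2 (hQ n hn).symm
      exact mul_left_cancel₀ e4 (by linear_combination e1 - e2)

end MacdonaldSum

namespace MacdonaldSum

open Matrix Finset

/-- Expanding a sum of two row-scaled Vandermonde matrices multilinearly along the rows. -/
theorem det_vandermonde_add_scaled {R : Type*} [CommRing R] {N : ℕ} (v a : Fin N → R) (c : R) :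
    (Matrix.of fun i k : Fin N => v i ^ (k : ℕ) + a i * (c * v i) ^ (k : ℕ)).det
      = ∑ I : Finset (Fin N), (∏ i ∈ I, a i) *
          (vandermonde fun i => if i ∈ I then c * v i else v i).det := by
  have h := (detRowAlternating (R := R) (n := Fin N)).toMultilinearMap.map_add_univ
    (fun i k => a i * (c * v i) ^ (k : ℕ)) (fun i k => v i ^ (k : ℕ))
  have h1 : (Matrix.of fun i k : Fin N => v i ^ (k : ℕ) + a i * (c * v i) ^ (k : ℕ))
      = (fun i k => a i * (c * v i) ^ (k : ℕ) : Fin N → Fin N → R)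
        + (fun i k => v i ^ (k : ℕ) : Fin N → Fin N → R) := by
    ext i k
    simp [add_comm]
  rw [h1]
  refine h.trans (sum_congr rfl fun I _ => ?_)
  have h2 : ∏ i ∈ I, a i = ∏ i, if i ∈ I then a i else 1 := by
    rw [prod_ite_mem, univ_inter]
  rw [h2, ← det_mul_column]
  refine congrArg Matrix.det ?_
  ext i k
  by_cases hi : i ∈ I <;> simp [Finset.piecewise, hi, vandermonde]

theorem sum_vandermonde_scaled_const {R : Type*} [CommRing R] {N : ℕ} (v : Fin N → R) (y c : R) :
    ∑ I : Finset (Fin N), y ^ #I *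
        (vandermonde fun i => if i ∈ I then c * v i else v i).det
      = (∏ k : Fin N, (1 + y * c ^ (k : ℕ))) * (vandermonde v).det := by
  have h := det_vandermonde_add_scaled v (fun _ => y) c
  simp only [prod_const] at h
  rw [← h, ← det_mul_row]
  refine congrArg Matrix.det ?_
  ext i k
  simp only [of_apply, vandermonde_apply, mul_pow]
  ring

theorem sum_vandermonde_scaled_sub_one {K : Type*} [Field K] {N : ℕ} (v : Fin N → K) (c : K)
    (hc : c ≠ 0) :
    ∑ I : Finset (Fin N), (-1) ^ #I * (∏ i ∈ I, (1 - v i)) *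
        (vandermonde fun i => if i ∈ I then c * v i else v i).det
      = (∏ k : Fin N, c ^ (k : ℕ)) * (∏ i, v i) * (vandermonde v).det := by
  have h := det_vandermonde_add_scaled v (fun i => -(1 - v i)) c
  simp only [prod_neg] at h
  rw [← h]
  have h2 : (∏ k : Fin N, c ^ (k : ℕ)) * (∏ i, v i) * (vandermonde v).det
      = (Matrix.of fun i k : Fin N => c ^ (k : ℕ) * v i ^ ((k : ℕ) + 1)).det := by
    rw [mul_assoc, ← det_mul_column, ← det_mul_row]
    refine congrArg Matrix.det ?_
    ext i k
    simp only [of_apply, vandermonde_apply]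
    ring
  rw [h2]
  symm
  cases N with
  | zero => simp
  | succ N =>
    refine det_eq_of_forall_col_eq_smul_add_pred
      (fun k => -(1 - c ^ ((k : ℕ) + 1)) / c ^ (k : ℕ)) (fun i => by simp) fun i k => ?_
    simp only [of_apply, Fin.val_succ, Fin.val_castSucc, mul_pow]
    field_simp
    ring

end MacdonaldSum

namespace MacdonaldSum

open Finset Matrix

section Weights

variable {K : Type*} [Field K] (Q T : K)

/-- The `Q`-shifted factorial `(z; Q)_n`. -/
def poch (z : K) (n : ℕ) : K := ∏ k ∈ range n, (1 - z * Q ^ k)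

theorem poch_succ (z : K) (n : ℕ) : poch Q z (n + 1) = poch Q z n * (1 - z * Q ^ n) :=
  prod_range_succ _ _

/-- The contribution to `weight` of a pair of rows at distance `m + 1` whose lengths differ
by `d`. -/
def pairWeight (m d : ℕ) : K :=
  poch Q (T ^ (m + 2)) d * poch Q (Q * T ^ (m + 1)) d
    / (poch Q (T ^ (m + 1)) d * poch Q (Q * T ^ m) d)

/-- The variables `Q^{r i} T^{N-1-i}` attached to a sequence of row lengths. -/
def rowVar {N : ℕ} (r : Fin N → ℕ) (i : Fin N) : K := Q ^ r i * T ^ (i.rev : ℕ)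

open Classical in
/-- The summand `P_λ(1, T, …, T^{N-1}) Q_λ(1, T, T², …)` for a partition with at most `N` rows,
extended by zero to all sequences of row lengths. -/
def weight {N : ℕ} (r : Fin N → ℕ) : K :=
  if Antitone r then
    T ^ (2 * ∑ i : Fin N, (i : ℕ) * r i) * (∏ i, (poch Q (Q * T ^ (i.rev : ℕ)) (r i))⁻¹)
      * ∏ i : Fin N, ∏ j ∈ Ioi i, pairWeight Q T ((j : ℕ) - i - 1) (r i - r j)
  else 0

/-- The vertical strip coefficient for adding one box in every row of `I`. -/
def addCoeff {N : ℕ} (r : Fin N → ℕ) (I : Finset (Fin N)) : K :=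
  (vandermonde fun i => if i ∈ I then T * rowVar Q T r i else rowVar Q T r i).det
    / (vandermonde (rowVar Q T r)).det

/-- The vertical strip coefficient for removing one box in every row of `I`. -/
def removeCoeff {N : ℕ} (r : Fin N → ℕ) (I : Finset (Fin N)) : K :=
  (∏ i ∈ I, (1 - rowVar Q T r i)) *
    ((vandermonde fun i => if i ∈ I then T⁻¹ * rowVar Q T r i else rowVar Q T r i).det
      / (vandermonde (rowVar Q T r)).det)

/-- Adding one box in every row of `I`. -/
def addStrip {N : ℕ} (I : Finset (Fin N)) (r : Fin N → ℕ) : Fin N → ℕ :=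
  fun i => r i + if i ∈ I then 1 else 0

/-- The sum of the weights of all sequences of row lengths of total size `n`. -/
def weightSum (N n : ℕ) : K := ∑ r ∈ piAntidiag (univ : Finset (Fin N)) n, weight Q T r

variable {Q T} (hQ : Q ≠ 0) (hT : T ≠ 0) (h : ∀ a b : ℕ, a ≠ 0 ∨ b ≠ 0 → 1 - Q ^ a * T ^ b ≠ 0)

include h in
theorem poch_ne_zero {a b : ℕ} (hab : a ≠ 0 ∨ b ≠ 0) (n : ℕ) : poch Q (Q ^ a * T ^ b) n ≠ 0 := by
  refine prod_ne_zero_iff.2 fun k _ => ?_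
  have := h (a + k) b (by omega)
  rwa [pow_add, mul_right_comm] at this

theorem pairWeight_succ (m d : ℕ) :
    pairWeight Q T m (d + 1) = pairWeight Q T m d
      * ((1 - Q ^ d * T ^ (m + 2)) * (1 - Q ^ (d + 1) * T ^ (m + 1))
        / ((1 - Q ^ d * T ^ (m + 1)) * (1 - Q ^ (d + 1) * T ^ m))) := by
  simp only [pairWeight, poch_succ]
  rw [div_mul_div_comm]
  congr 1 <;> ring

include hQ hT h in
theorem pairWeight_balance (m b d d' z : ℕ) (x y : ℕ) (hx : x ≤ 1) (hy : y ≤ 1)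
    (hd : b + d + x = b + y + d') :
    pairWeight Q T m d *
      ((T ^ y * (Q ^ b * T ^ z) - T ^ x * (Q ^ (b + d) * T ^ (z + m + 1)))
        / (Q ^ b * T ^ z - Q ^ (b + d) * T ^ (z + m + 1)))
    = T ^ (2 * y) * pairWeight Q T m d' *
      ((T⁻¹ ^ y * (Q ^ (b + y) * T ^ z) - T⁻¹ ^ x * (Q ^ (b + d + x) * T ^ (z + m + 1)))
        / (Q ^ (b + y) * T ^ z - Q ^ (b + d + x) * T ^ (z + m + 1))) := by
  have e : ∀ (c d : ℕ) (u v : K),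
      (u * (Q ^ c * T ^ z) - v * (Q ^ (c + d) * T ^ (z + m + 1)))
        / (Q ^ c * T ^ z - Q ^ (c + d) * T ^ (z + m + 1))
      = (u - v * (Q ^ d * T ^ (m + 1))) / (1 - Q ^ d * T ^ (m + 1)) := by
    intro c d u v
    rw [← mul_div_mul_left (u - _) _ (mul_ne_zero (pow_ne_zero c hQ) (pow_ne_zero z hT))]
    congr 1 <;> ring
  have e3 : ∀ d, 1 - Q ^ d * T ^ (m + 1) ≠ 0 := fun d => h _ _ (by omega)
  have e4 : ∀ d, 1 - Q ^ (d + 1) * T ^ m ≠ 0 := fun d => h _ _ (by omega)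
  have e5 := e3 d
  have e6 := e3 d'
  rw [hd, e, e]
  interval_cases x <;> interval_cases y
  · obtain rfl : d = d' := by omega
    simp
  · obtain rfl : d = d' + 1 := by omega
    have e7 := e4 d'
    rw [pairWeight_succ]
    rw [mul_assoc, mul_comm (T ^ (2 * 1)), mul_assoc]
    congr 1
    field_simp
    ring
  · obtain rfl : d' = d + 1 := by omega
    have e7 := e4 d
    rw [pairWeight_succ]
    rw [mul_comm (T ^ (2 * 0)), mul_assoc, mul_assoc]
    congr 1
    have k1 : T⁻¹ ^ 1 * (Q ^ (d + 1) * T ^ (m + 1)) = Q ^ (d + 1) * T ^ m := by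
      field_simp
      ring
    have k2 : Q ^ d * T ^ (m + 2) = T ^ 1 * (Q ^ d * T ^ (m + 1)) := by ring
    rw [k1, k2]
    generalize Q ^ (d + 1) * T ^ (m + 1) = u at *
    generalize Q ^ d * T ^ (m + 1) = v at *
    generalize Q ^ (d + 1) * T ^ m = w at *
    field_simp
    ring
  · obtain rfl : d = d' := by omega
    rw [mul_comm (T ^ (2 * 1)), mul_assoc]
    congr 1
    field_simp

include hQ hT h in
theorem rowVar_sub_ne_zero {N : ℕ} {r : Fin N → ℕ} (hr : Antitone r) {i j : Fin N} (hij : i < j) :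
    rowVar Q T r j - rowVar Q T r i ≠ 0 := by
  have h1 : r i = r j + (r i - r j) := by
    have := hr hij.le
    omega
  have h2 : (i.rev : ℕ) = j.rev + (j - i) := by
    simp only [Fin.val_rev]
    omega
  have : rowVar Q T r j - rowVar Q T r i = Q ^ r j * T ^ (j.rev : ℕ)
      * (1 - Q ^ (r i - r j) * T ^ ((j : ℕ) - i)) := by
    have h3 : Q ^ r i = Q ^ r j * Q ^ (r i - r j) := by rw [← pow_add, ← h1]
    rw [rowVar, rowVar, h2, h3]
    ring
  rw [this]
  exact mul_ne_zero (mul_ne_zero (pow_ne_zero _ hQ) (pow_ne_zero _ hT)) (h _ _ (by omega))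

include hQ hT h in
theorem det_rowVar_ne_zero {N : ℕ} {r : Fin N → ℕ} (hr : Antitone r) :
    (vandermonde (rowVar Q T r)).det ≠ 0 := by
  rw [det_vandermonde]
  exact prod_ne_zero_iff.2 fun i _ => prod_ne_zero_iff.2 fun j hj =>
    rowVar_sub_ne_zero hQ hT h hr (mem_Ioi.1 hj)

theorem prod_pow_val_eq {N : ℕ} (c : Fin N → K) :
    ∏ i : Fin N, ∏ j ∈ Ioi i, c j = ∏ j : Fin N, c j ^ (j : ℕ) := by
  rw [prod_comm' (t' := univ) (s' := fun j => Iio j) (by simp)]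
  simp

include hQ hT h in
theorem weight_mul_addCoeff_of_antitone {N : ℕ} {r : Fin N → ℕ} {I : Finset (Fin N)}
    (hr : Antitone r) (hr' : Antitone (addStrip I r)) :
    weight Q T r * addCoeff Q T r I
      = weight Q T (addStrip I r) * removeCoeff Q T (addStrip I r) I := by
  have hvar : ∀ (c : K) (r : Fin N → ℕ) (i : Fin N),
      (if i ∈ I then c * rowVar Q T r i else rowVar Q T r i)
        = c ^ (if i ∈ I then 1 else 0) * rowVar Q T r i := by
    intro c r i
    split_ifs <;> simp
  have h1 : ∏ i : Fin N, ∏ j ∈ Ioi i, (pairWeight Q T ((j : ℕ) - i - 1) (r i - r j)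
        * ((T ^ (if j ∈ I then 1 else 0) * rowVar Q T r j
            - T ^ (if i ∈ I then 1 else 0) * rowVar Q T r i)
          / (rowVar Q T r j - rowVar Q T r i)))
      = ∏ i : Fin N, ∏ j ∈ Ioi i, (T ^ (2 * if j ∈ I then 1 else 0)
        * pairWeight Q T ((j : ℕ) - i - 1) (addStrip I r i - addStrip I r j)
        * ((T⁻¹ ^ (if j ∈ I then 1 else 0) * rowVar Q T (addStrip I r) j
            - T⁻¹ ^ (if i ∈ I then 1 else 0) * rowVar Q T (addStrip I r) i)
          / (rowVar Q T (addStrip I r) j - rowVar Q T (addStrip I r) i))) := by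
    refine prod_congr rfl fun i _ => prod_congr rfl fun j hj => ?_
    have hij := mem_Ioi.1 hj
    have hij' : (i : ℕ) < j := hij
    have e1 := hr hij.le
    have e2 := hr' hij.le
    have e3 : (i.rev : ℕ) = j.rev + (j - i - 1) + 1 := by
      simp only [Fin.val_rev]
      omega
    have e4 : r i = r j + (r i - r j) := by omega
    have key := pairWeight_balance hQ hT h ((j : ℕ) - i - 1) (r j) (r i - r j)
      (addStrip I r i - addStrip I r j) (j.rev : ℕ) (if i ∈ I then 1 else 0)
      (if j ∈ I then 1 else 0) (by split_ifs <;> simp) (by split_ifs <;> simp)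
      (by simp only [addStrip] at e2 ⊢; omega)
    rw [← e3, ← e4] at key
    exact key
  have h2 : ∏ i : Fin N, (poch Q (Q * T ^ (i.rev : ℕ)) (r i))⁻¹
      = (∏ i : Fin N, (poch Q (Q * T ^ (i.rev : ℕ)) (addStrip I r i))⁻¹)
        * ∏ i ∈ I, (1 - rowVar Q T (addStrip I r) i) := by
    have e0 : ∏ i ∈ I, (1 - rowVar Q T (addStrip I r) i)
        = ∏ i, if i ∈ I then 1 - rowVar Q T (addStrip I r) i else 1 := by
      rw [prod_ite_mem, univ_inter]
    rw [e0, ← prod_mul_distrib]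
    refine prod_congr rfl fun i _ => ?_
    by_cases hi : i ∈ I
    · have e1 := h (r i + 1) i.rev (by omega)
      have e2 : 1 - Q * T ^ (i.rev : ℕ) * Q ^ r i = 1 - Q ^ (r i + 1) * T ^ (i.rev : ℕ) := by ring
      simp only [addStrip, hi, if_true, poch_succ, rowVar, e2, mul_inv]
      rw [mul_assoc, inv_mul_cancel₀ e1, mul_one]
    · simp [addStrip, hi]
  have h3 : T ^ (2 * ∑ i : Fin N, (i : ℕ) * addStrip I r i)
      = T ^ (2 * ∑ i : Fin N, (i : ℕ) * r i)
        * ∏ i : Fin N, ∏ j ∈ Ioi i, T ^ (2 * if j ∈ I then 1 else 0) := by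
    rw [prod_pow_val_eq]
    simp_rw [← pow_mul]
    rw [prod_pow_eq_pow_sum, ← pow_add, mul_sum, mul_sum, ← sum_add_distrib]
    congr 1
    refine sum_congr rfl fun i _ => ?_
    simp only [addStrip]
    ring
  simp only [prod_mul_distrib, prod_div_distrib] at h1
  rw [weight, weight, if_pos hr, if_pos hr', addCoeff, removeCoeff, h2, h3]
  simp_rw [hvar]
  simp only [det_vandermonde]
  linear_combination T ^ (2 * ∑ i : Fin N, (i : ℕ) * r i)
    * (∏ i : Fin N, (poch Q (Q * T ^ (i.rev : ℕ)) (addStrip I r i))⁻¹)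
    * (∏ i ∈ I, (1 - rowVar Q T (addStrip I r) i)) * h1

theorem addCoeff_eq_zero {N : ℕ} {r : Fin N → ℕ} {I : Finset (Fin N)}
    (hr : Antitone r) (hr' : ¬ Antitone (addStrip I r)) : addCoeff Q T r I = 0 := by
  cases N with
  | zero => exact absurd (fun i => i.elim0) hr'
  | succ N =>
    rw [Fin.antitone_iff_succ_le] at hr'
    push Not at hr'
    obtain ⟨i, hi⟩ := hr'
    have h1 := hr (Fin.castSucc_lt_succ (i := i)).le
    have h2 : i.succ ∈ I ∧ i.castSucc ∉ I ∧ r i.succ = r i.castSucc := by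
      simp only [addStrip] at hi
      split_ifs at hi <;> first | omega | exact ⟨‹_›, ‹_›, by omega⟩
    have h3 : (i.castSucc.rev : ℕ) = i.succ.rev + 1 := by
      simp only [Fin.val_rev, Fin.val_succ, Fin.val_castSucc]
      omega
    rw [addCoeff, det_vandermonde_eq_zero_iff.2, zero_div]
    refine ⟨i.castSucc, i.succ, ?_, (Fin.castSucc_lt_succ (i := i)).ne⟩
    rw [if_neg h2.2.1, if_pos h2.1, rowVar, rowVar, h2.2.2, h3]
    ring

include hT in
theorem removeCoeff_eq_zero_of_eq {N : ℕ} {r : Fin (N + 1) → ℕ} {I : Finset (Fin (N + 1))}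
    {i : Fin N} (h1 : i.castSucc ∈ I) (h2 : i.succ ∉ I) (h3 : r i.castSucc = r i.succ) :
    removeCoeff Q T r I = 0 := by
  have h4 : (i.castSucc.rev : ℕ) = i.succ.rev + 1 := by
    simp only [Fin.val_rev, Fin.val_succ, Fin.val_castSucc]
    omega
  rw [removeCoeff, det_vandermonde_eq_zero_iff.2, zero_div, mul_zero]
  refine ⟨i.castSucc, i.succ, ?_, (Fin.castSucc_lt_succ (i := i)).ne⟩
  rw [if_neg h2, if_pos h1, rowVar, rowVar, h3, h4]
  field_simp
  ring

include hT in
theorem removeCoeff_addStrip_eq_zero {N : ℕ} {r : Fin N → ℕ} {I : Finset (Fin N)}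
    (hr : ¬ Antitone r) (hr' : Antitone (addStrip I r)) :
    removeCoeff Q T (addStrip I r) I = 0 := by
  cases N with
  | zero => exact absurd (fun i => i.elim0) hr
  | succ N =>
    rw [Fin.antitone_iff_succ_le] at hr
    push Not at hr
    obtain ⟨i, hi⟩ := hr
    have h1 := hr' (Fin.castSucc_lt_succ (i := i)).le
    have h2 : i.castSucc ∈ I ∧ i.succ ∉ I ∧ r i.castSucc + 1 = r i.succ := by
      simp only [addStrip] at h1
      split_ifs at h1 <;> first | omega | exact ⟨‹_›, ‹_›, by omega⟩
    refine removeCoeff_eq_zero_of_eq hT h2.1 h2.2.1 ?_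
    simp only [addStrip, if_pos h2.1, if_neg h2.2.1]
    omega

include hT in
theorem removeCoeff_eq_zero_of_apply_eq_zero {N : ℕ} {r : Fin N → ℕ} {I : Finset (Fin N)}
    (hr : Antitone r) {i : Fin N} (hi : i ∈ I) (h0 : r i = 0) : removeCoeff Q T r I = 0 := by
  cases N with
  | zero => exact i.elim0
  | succ N =>
    induction i using Fin.reverseInduction with
    | last =>
      rw [removeCoeff, prod_eq_zero hi, zero_mul]
      simp [rowVar, h0]
    | cast i ih =>
      have h1 := hr (Fin.castSucc_lt_succ (i := i)).le
      have h2 : r i.succ = 0 := by omega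
      by_cases h3 : i.succ ∈ I
      · exact ih h3 h2
      · exact removeCoeff_eq_zero_of_eq hT hi h3 (by omega)

include hQ hT h in
theorem weight_mul_addCoeff {N : ℕ} (r : Fin N → ℕ) (I : Finset (Fin N)) :
    weight Q T r * addCoeff Q T r I
      = weight Q T (addStrip I r) * removeCoeff Q T (addStrip I r) I := by
  by_cases hr : Antitone r <;> by_cases hr' : Antitone (addStrip I r)
  · exact weight_mul_addCoeff_of_antitone hQ hT h hr hr'
  · rw [addCoeff_eq_zero hr hr', mul_zero, weight, if_neg hr', zero_mul]
  · rw [removeCoeff_addStrip_eq_zero hT hr hr', mul_zero, weight, if_neg hr, zero_mul]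
  · rw [weight, if_neg hr, weight, if_neg hr', zero_mul, zero_mul]

theorem sum_addStrip {N : ℕ} (I : Finset (Fin N)) (r : Fin N → ℕ) :
    ∑ i, addStrip I r i = ∑ i, r i + #I := by
  simp [addStrip, sum_add_distrib]

include hQ hT h in
theorem sum_weight_mul_addCoeff {N : ℕ} (I : Finset (Fin N)) (n : ℕ) :
    ∑ r ∈ piAntidiag univ n, weight Q T r * addCoeff Q T r I
      = ∑ r ∈ piAntidiag univ (n + #I), weight Q T r * removeCoeff Q T r I := by
  refine sum_of_injOn (addStrip I) (fun r _ r' _ he => ?_) (fun r hr => ?_) (fun r hr hr' => ?_)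
    fun r _ => weight_mul_addCoeff hQ hT h r I
  · ext i
    simpa [addStrip] using congrFun he i
  · simp only [Finset.mem_coe, mem_piAntidiag] at hr ⊢
    simp_all [sum_addStrip]
  · by_cases ha : Antitone r
    · by_cases h0 : ∃ i ∈ I, r i = 0
      · obtain ⟨i, hi, h0⟩ := h0
        rw [removeCoeff_eq_zero_of_apply_eq_zero hT ha hi h0, mul_zero]
      · push Not at h0
        refine absurd ⟨fun i => r i - if i ∈ I then 1 else 0, ?_, ?_⟩ hr'
        · have h1 : addStrip I (fun i => r i - if i ∈ I then 1 else 0) = r := by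
            ext i
            by_cases hi : i ∈ I
            · have := h0 i hi
              simp only [addStrip, hi, if_true]
              omega
            · simp [addStrip, hi]
          have h2 := sum_addStrip I (fun i => r i - if i ∈ I then 1 else 0)
          rw [h1, (mem_piAntidiag.1 hr).1] at h2
          simpa using h2.symm
        · ext i
          by_cases hi : i ∈ I
          · have := h0 i hi
            simp only [addStrip, hi, if_true]
            omega
          · simp [addStrip, hi]
    · rw [weight, if_neg ha, zero_mul]

include hQ hT h in
theorem coeff_prod_eq_sum_addCoeff {N : ℕ} {r : Fin N → ℕ} (hr : Antitone r) (k : ℕ) :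
    PowerSeries.coeff k (∏ j ∈ range N, (1 - PowerSeries.C (T ^ j) * PowerSeries.X))
      = ∑ I : Finset (Fin N), if #I = k then (-1) ^ #I * addCoeff Q T r I else 0 := by
  have hd := det_rowVar_ne_zero hQ hT h hr
  have key := sum_vandermonde_scaled_const (fun i => PowerSeries.C (rowVar Q T r i))
    (-PowerSeries.X) (PowerSeries.C T)
  have hmap : ∀ v : Fin N → K, (vandermonde fun i => PowerSeries.C (v i)).det
      = PowerSeries.C (vandermonde v).det := by
    intro v
    simp [det_vandermonde]
  have hite : ∀ I : Finset (Fin N), (fun i => if i ∈ I then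
      PowerSeries.C T * PowerSeries.C (rowVar Q T r i) else PowerSeries.C (rowVar Q T r i))
      = fun i => PowerSeries.C (if i ∈ I then T * rowVar Q T r i else rowVar Q T r i) := by
    intro I
    ext1 i
    split_ifs <;> simp
  simp only [hite, hmap] at key
  have hprod : ∏ j : Fin N, (1 + -PowerSeries.X * PowerSeries.C T ^ (j : ℕ))
      = ∏ j ∈ range N, (1 - PowerSeries.C (T ^ j) * PowerSeries.X) := by
    rw [prod_range]
    refine prod_congr rfl fun j _ => ?_
    rw [map_pow]
    ring
  rw [hprod] at key
  have key' := congrArg (PowerSeries.coeff k) key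
  rw [PowerSeries.coeff_mul_C, map_sum] at key'
  rw [← mul_left_inj' hd, ← key', sum_mul]
  refine sum_congr rfl fun I _ => ?_
  have hX : (-PowerSeries.X : PowerSeries K) ^ #I
      = PowerSeries.C ((-1) ^ #I) * PowerSeries.X ^ #I := by
    rw [neg_pow]
    simp
  rw [PowerSeries.coeff_mul_C, hX, PowerSeries.coeff_C_mul, PowerSeries.coeff_X_pow, addCoeff]
  by_cases hI : #I = k
  · rw [if_pos hI, if_pos hI.symm]
    field_simp
  · rw [if_neg hI, if_neg (Ne.symm hI)]
    ring

include hQ hT h in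
theorem sum_removeCoeff {N : ℕ} {r : Fin N → ℕ} (hr : Antitone r) :
    ∑ I : Finset (Fin N), (-1) ^ #I * removeCoeff Q T r I = Q ^ ∑ i, r i := by
  have hd := det_rowVar_ne_zero hQ hT h hr
  have key := sum_vandermonde_scaled_sub_one (rowVar Q T r) T⁻¹ (inv_ne_zero hT)
  have h1 : (∏ k : Fin N, T⁻¹ ^ (k : ℕ)) * ∏ i, rowVar Q T r i = Q ^ ∑ i, r i := by
    rw [← Equiv.prod_comp Fin.revPerm, ← prod_mul_distrib, ← prod_pow_eq_pow_sum]
    refine prod_congr rfl fun i _ => ?_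
    simp only [Fin.revPerm_apply, rowVar, inv_pow]
    field_simp
  rw [h1] at key
  rw [← mul_left_inj' hd, ← key, sum_mul]
  refine sum_congr rfl fun I _ => ?_
  rw [removeCoeff]
  field_simp

include hQ hT h in
/-- The generating function of `weightSum` satisfies a `Q`-difference equation. -/
theorem prod_mul_mk_weightSum (N : ℕ) :
    (∏ j ∈ range N, (1 - PowerSeries.C (T ^ j) * PowerSeries.X))
        * PowerSeries.mk (weightSum Q T N)
      = PowerSeries.rescale Q (PowerSeries.mk (weightSum Q T N)) := by
  ext n
  rw [PowerSeries.coeff_mul, PowerSeries.coeff_rescale, PowerSeries.coeff_mk]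
  have h1 : ∀ x : ℕ × ℕ,
      PowerSeries.coeff x.1 (∏ j ∈ range N, (1 - PowerSeries.C (T ^ j) * PowerSeries.X))
        * PowerSeries.coeff x.2 (PowerSeries.mk (weightSum Q T N))
      = ∑ I : Finset (Fin N), if #I = x.1 then
          (-1) ^ #I * ∑ r ∈ piAntidiag univ x.2, weight Q T r * addCoeff Q T r I else 0 := by
    intro x
    have h2 : ∀ I : Finset (Fin N), (if #I = x.1 then
          (-1) ^ #I * ∑ r ∈ piAntidiag univ x.2, weight Q T r * addCoeff Q T r I else 0)
        = ∑ r ∈ piAntidiag univ x.2, weight Q T r *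
          (if #I = x.1 then (-1) ^ #I * addCoeff Q T r I else 0) := by
      intro I
      split_ifs
      · rw [mul_sum]
        exact sum_congr rfl fun r _ => by ring
      · simp
    rw [PowerSeries.coeff_mk, weightSum, mul_sum, sum_congr rfl fun I _ => h2 I, sum_comm]
    refine sum_congr rfl fun r _ => ?_
    rw [← mul_sum]
    by_cases hr : Antitone r
    · rw [← coeff_prod_eq_sum_addCoeff hQ hT h hr, mul_comm]
    · rw [weight, if_neg hr, zero_mul, mul_zero]
  rw [sum_congr rfl fun x _ => h1 x, sum_comm]
  have h3 : ∀ I : Finset (Fin N), (∑ x ∈ HasAntidiagonal.antidiagonal n, if #I = x.1 then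
          (-1) ^ #I * ∑ r ∈ piAntidiag univ x.2, weight Q T r * addCoeff Q T r I else 0)
      = ∑ r ∈ piAntidiag univ n, weight Q T r * ((-1) ^ #I * removeCoeff Q T r I) := by
    intro I
    have h4 : ∑ r ∈ piAntidiag univ n, weight Q T r * ((-1) ^ #I * removeCoeff Q T r I)
        = (-1) ^ #I * ∑ r ∈ piAntidiag univ n, weight Q T r * removeCoeff Q T r I := by
      rw [mul_sum]
      exact sum_congr rfl fun r _ => by ring
    rw [h4]
    by_cases hn : #I ≤ n
    · rw [sum_eq_single (#I, n - #I)]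
      · simp only [if_true]
        rw [sum_weight_mul_addCoeff hQ hT h, Nat.sub_add_cancel hn]
      · intro x hx hne
        rw [if_neg]
        rintro hI
        have := HasAntidiagonal.mem_antidiagonal.1 hx
        exact hne (Prod.ext hI.symm (by simp only; omega))
      · intro hx
        exact absurd (HasAntidiagonal.mem_antidiagonal.2 (by simp only; omega)) hx
    · rw [sum_eq_zero, sum_eq_zero, mul_zero]
      · intro r hr
        by_cases ha : Antitone r
        · have h5 : ∃ i ∈ I, r i = 0 := by
            by_contra! h0
            have h6 : #I ≤ ∑ i ∈ I, r i := by
              rw [card_eq_sum_ones]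
              exact sum_le_sum fun i hi => Nat.one_le_iff_ne_zero.2 (h0 i hi)
            have h7 := sum_le_univ_sum_of_nonneg (s := I) (fun i => Nat.zero_le (r i))
            rw [(mem_piAntidiag.1 hr).1] at h7
            omega
          obtain ⟨i, hi, h0⟩ := h5
          rw [removeCoeff_eq_zero_of_apply_eq_zero hT ha hi h0, mul_zero]
        · rw [weight, if_neg ha, zero_mul]
      · intro x hx
        have := HasAntidiagonal.mem_antidiagonal.1 hx
        rw [if_neg (by omega)]
  rw [sum_congr rfl fun I _ => h3 I, sum_comm, weightSum, mul_sum]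
  refine sum_congr rfl fun r hr => ?_
  rw [← mul_sum]
  by_cases ha : Antitone r
  · rw [sum_removeCoeff hQ hT h ha, (mem_piAntidiag.1 hr).1, mul_comm]
  · rw [weight, if_neg ha, zero_mul, mul_zero]

theorem weightSum_zero (N : ℕ) : weightSum Q T N 0 = 1 := by
  have : Antitone (0 : Fin N → ℕ) := fun _ _ _ => le_rfl
  simp [weightSum, weight, this, poch, pairWeight]

end Weights

end MacdonaldSum

namespace MacdonaldSum

open Finset

section Diagram

variable {n : ℕ} {r : ℕ → ℕ}

theorem mem_cellsR_iff (hb : ∀ i, r i ≤ n) (h0 : ∀ i, n ≤ i → r i = 0) {N : ℕ} (hN : n ≤ N)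
    (s : ℕ × ℕ) : s ∈ cellsR n r ↔ s.1 ∈ range N ∧ s.2 ∈ range (r s.1) := by
  have h1 := hb s.1
  have h2 := h0 s.1
  simp only [cellsR, mem_filter, mem_product, mem_range]
  constructor
  · rintro ⟨⟨h3, -⟩, h4⟩
    exact ⟨by omega, h4⟩
  · rintro ⟨-, h4⟩
    refine ⟨⟨?_, by omega⟩, h4⟩
    by_contra h5
    have := h2 (by omega)
    omega

theorem conjR_eq (hr : Antitone r) (h0 : ∀ i, n ≤ i → r i = 0) {j c : ℕ} (h1 : r (j + 1) ≤ c)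
    (h2 : c < r j) : conjR n r c = j + 1 := by
  have : (range n).filter (fun i => c < r i) = range (j + 1) := by
    ext i
    simp only [mem_filter, mem_range]
    constructor
    · rintro ⟨-, h⟩
      by_contra h3
      have := hr (show j + 1 ≤ i by omega)
      omega
    · intro h
      have h3 := hr (show i ≤ j by omega)
      refine ⟨?_, by omega⟩
      by_contra h4
      have := h0 i (by omega)
      omega
  rw [conjR, this, card_range]

theorem lt_conjR (hr : Antitone r) (h0 : ∀ i, n ≤ i → r i = 0) {i c : ℕ} (h : c < r i) :
    i < conjR n r c := by
  have hex : ∃ j, r (j + 1) ≤ c := ⟨n, by rw [h0 _ (by omega)]; omega⟩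
  obtain ⟨j, hj, hj'⟩ : ∃ j, r (j + 1) ≤ c ∧ c < r j := by
    refine ⟨Nat.find hex, Nat.find_spec hex, ?_⟩
    rcases Nat.eq_zero_or_pos (Nat.find hex) with h1 | h1
    · rw [h1]
      exact h.trans_le (hr (Nat.zero_le i))
    · have h2 : ¬ r (Nat.find hex - 1 + 1) ≤ c := Nat.find_min hex (Nat.sub_lt h1 one_pos)
      rw [Nat.sub_add_cancel (show 1 ≤ _ from h1)] at h2
      omega
  rw [conjR_eq hr h0 hj hj']
  by_contra h2
  have := hr (show j + 1 ≤ i by omega)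
  omega

end Diagram

section RowProducts

variable {K : Type*} [Field K] {Q T : K}

theorem poch_mul_prod_Ico (z : K) {a b R : ℕ} (hab : a ≤ b) (hb : b ≤ R) :
    poch Q z (R - b) * ∏ c ∈ Ico a b, (1 - z * Q ^ (R - c - 1)) = poch Q z (R - a) := by
  rcases Nat.eq_zero_or_pos R with rfl | hR
  · simp [show a = b by omega]
  · have h := prod_Ico_reflect (fun k => 1 - z * Q ^ k) a (m := b) (n := R - 1) (by omega)
    rw [Nat.sub_add_cancel hR] at h
    simp only [Nat.sub_right_comm R 1] at h
    rw [h]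
    exact prod_range_mul_prod_Ico _ (by omega)

theorem prod_row {n : ℕ} {r : ℕ → ℕ} (hr : Antitone r) (h0 : ∀ i, n ≤ i → r i = 0) {x : K}
    (hx : ∀ m d, poch Q (x * T ^ m) d ≠ 0) (i M : ℕ) :
    ∏ c ∈ Ico (r (i + M + 1)) (r i), (1 - x * T ^ (conjR n r c - i - 1) * Q ^ (r i - c - 1))
      = poch Q (x * T ^ M) (r i - r (i + M + 1)) *
        ∏ m ∈ range M, poch Q (x * T ^ m) (r i - r (i + m + 1)) /
          poch Q (x * T ^ (m + 1)) (r i - r (i + m + 1)) := by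
  have strip : ∀ m, poch Q (x * T ^ m) (r i - r (i + m)) *
      ∏ c ∈ Ico (r (i + m + 1)) (r (i + m)),
        (1 - x * T ^ (conjR n r c - i - 1) * Q ^ (r i - c - 1))
      = poch Q (x * T ^ m) (r i - r (i + m + 1)) := by
    intro m
    rw [← poch_mul_prod_Ico (x * T ^ m) (hr (show i + m ≤ i + m + 1 by omega))
      (hr (show i ≤ i + m by omega))]
    congr 1
    refine prod_congr rfl fun c hc => ?_
    obtain ⟨h1, h2⟩ := mem_Ico.1 hc
    rw [conjR_eq hr h0 h1 h2, show i + m + 1 - i - 1 = m by omega]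
  induction M with
  | zero => simpa [poch] using strip 0
  | succ M ih =>
    have h1 := strip (M + 1)
    rw [← prod_Ico_consecutive _ (hr (show i + (M + 1) ≤ i + (M + 1) + 1 by omega))
      (hr (show i ≤ i + (M + 1) by omega)), ← h1, ← add_assoc i M 1, ih, prod_range_succ]
    have h2 := hx (M + 1) (r i - r (i + M + 1))
    field_simp

end RowProducts

theorem one_sub_q_pow_mul_t_pow_ne_zero {a b : ℕ} (h : a ≠ 0 ∨ b ≠ 0) :
    1 - q ^ a * t ^ b ≠ 0 := by
  intro h1
  have h2 : algebraMap (MvPolynomial (Fin 2) ℚ) F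
      (1 - MvPolynomial.X 0 ^ a * MvPolynomial.X 1 ^ b) = 0 := by
    simpa [q, t] using h1
  have h3 := (map_eq_zero_iff _ (IsFractionRing.injective (MvPolynomial (Fin 2) ℚ) F)).1 h2
  have h4 := congrArg (MvPolynomial.eval fun _ => (2 : ℚ)) h3
  simp only [map_sub, map_one, map_mul, map_pow, MvPolynomial.eval_X, map_zero, ← pow_add] at h4
  have h5 : (1 : ℚ) < 2 ^ (a + b) := one_lt_pow₀ (by norm_num) (by omega)
  linarith

theorem q_ne_zero : q ≠ 0 :=
  (map_ne_zero_iff _ (IsFractionRing.injective (MvPolynomial (Fin 2) ℚ) F)).2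
    (MvPolynomial.X_ne_zero _)

theorem t_ne_zero : t ≠ 0 :=
  (map_ne_zero_iff _ (IsFractionRing.injective (MvPolynomial (Fin 2) ℚ) F)).2
    (MvPolynomial.X_ne_zero _)

theorem q_pow_ne_one {m : ℕ} (hm : m ≠ 0) : q ^ m ≠ 1 := by
  have := one_sub_q_pow_mul_t_pow_ne_zero (b := 0) (Or.inl hm)
  rw [pow_zero, mul_one] at this
  exact (sub_ne_zero.1 this).symm

theorem t_pow_ne_one {m : ℕ} (hm : m ≠ 0) : t ^ m ≠ 1 := by
  have := one_sub_q_pow_mul_t_pow_ne_zero (a := 0) (Or.inr hm)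
  rw [pow_zero, one_mul] at this
  exact (sub_ne_zero.1 this).symm

theorem weightSum_eq_hSum (N n : ℕ) :
    weightSum q t N n = hSum (fun m => (1 - (t ^ N) ^ m) / ((1 - q ^ m) * (1 - t ^ m))) n := by
  have h := eq_mk_hSum_of_prod_mul_eq_rescale (fun _ => q_pow_ne_one) (fun _ => t_pow_ne_one)
    (f := PowerSeries.mk (weightSum q t N)) (by simp [weightSum_zero])
    (prod_mul_mk_weightSum q_ne_zero t_ne_zero (fun _ _ => one_sub_q_pow_mul_t_pow_ne_zero) N)
  simpa using congrArg (PowerSeries.coeff n) h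

theorem poch_t_ne_zero (m d : ℕ) : poch q (t * t ^ m) d ≠ 0 := by
  have := poch_ne_zero (fun _ _ => one_sub_q_pow_mul_t_pow_ne_zero) (a := 0) (b := m + 1)
    (Or.inr m.succ_ne_zero) d
  rwa [pow_zero, one_mul, pow_succ'] at this

theorem poch_q_ne_zero (m d : ℕ) : poch q (q * t ^ m) d ≠ 0 := by
  have := poch_ne_zero (fun _ _ => one_sub_q_pow_mul_t_pow_ne_zero) (a := 1) (b := m)
    (Or.inl one_ne_zero) d
  rwa [pow_one] at this

section Hooks

variable {n : ℕ} {r : ℕ → ℕ}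

theorem cfun_mul_cfun'_eq (hr : Antitone r) (hb : ∀ i, r i ≤ n) (h0 : ∀ i, n ≤ i → r i = 0)
    {N : ℕ} (hN : n ≤ N) :
    cfun n r * cfun' n r * ∏ i ∈ range N, ∏ m ∈ range (N - 1 - i),
        pairWeight q t m (r i - r (i + m + 1))
      = (∏ i ∈ range N, poch q (t ^ (N - i)) (r i)) *
        ∏ i ∈ range N, poch q (q * t ^ (N - 1 - i)) (r i) := by
  have h1 : cfun n r = ∏ i ∈ range N, ∏ c ∈ Ico (r N) (r i),
      (1 - t * t ^ (conjR n r c - i - 1) * q ^ (r i - c - 1)) := by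
    rw [cfun, prod_finset_product _ (range N) (fun i => range (r i)) (mem_cellsR_iff hb h0 hN), h0 N hN]
    simp only [← range_eq_Ico]
    refine prod_congr rfl fun i _ => prod_congr rfl fun c hc => ?_
    have hc := mem_range.1 hc
    have hl := lt_conjR hr h0 hc
    rw [cArm, show armR r (i, c) = ((r i - c - 1 : ℕ) : ℤ) by simp only [armR]; omega,
      show legR n r (i, c) + 1 = ((conjR n r c - i - 1 + 1 : ℕ) : ℤ) by simp only [legR]; omega,
      zpow_natCast, zpow_natCast]
    ring
  have h2 : cfun' n r = ∏ i ∈ range N, ∏ c ∈ Ico (r N) (r i),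
      (1 - q * t ^ (conjR n r c - i - 1) * q ^ (r i - c - 1)) := by
    rw [cfun', prod_finset_product _ (range N) (fun i => range (r i)) (mem_cellsR_iff hb h0 hN), h0 N hN]
    simp only [← range_eq_Ico]
    refine prod_congr rfl fun i _ => prod_congr rfl fun c hc => ?_
    have hc := mem_range.1 hc
    have hl := lt_conjR hr h0 hc
    rw [cArm', show armR r (i, c) + 1 = ((r i - c - 1 + 1 : ℕ) : ℤ) by simp only [armR]; omega,
      show legR n r (i, c) = ((conjR n r c - i - 1 : ℕ) : ℤ) by simp only [legR]; omega,
      zpow_natCast, zpow_natCast]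
    ring
  rw [h1, h2, ← prod_mul_distrib, ← prod_mul_distrib, ← prod_mul_distrib]
  refine prod_congr rfl fun i hi => ?_
  obtain ⟨M, rfl⟩ : ∃ M, N = i + M + 1 := ⟨N - i - 1, by have := mem_range.1 hi; omega⟩
  rw [prod_row hr h0 poch_t_ne_zero, prod_row hr h0 poch_q_ne_zero, h0 (i + M + 1) hN,
    show i + M + 1 - 1 - i = M by omega, show i + M + 1 - i = M + 1 by omega, ← pow_succ',
    Nat.sub_zero]
  have h3 : (∏ m ∈ range M, poch q (t * t ^ m) (r i - r (i + m + 1)) /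
          poch q (t * t ^ (m + 1)) (r i - r (i + m + 1))) *
      (∏ m ∈ range M, poch q (q * t ^ m) (r i - r (i + m + 1)) /
          poch q (q * t ^ (m + 1)) (r i - r (i + m + 1))) *
      ∏ m ∈ range M, pairWeight q t m (r i - r (i + m + 1)) = 1 := by
    rw [← prod_mul_distrib, ← prod_mul_distrib]
    refine prod_eq_one fun m _ => ?_
    have e1 := poch_t_ne_zero m (r i - r (i + m + 1))
    have e2 := poch_t_ne_zero (m + 1) (r i - r (i + m + 1))
    have e3 := poch_q_ne_zero m (r i - r (i + m + 1))
    have e4 := poch_q_ne_zero (m + 1) (r i - r (i + m + 1))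
    rw [pairWeight, pow_succ' t (m + 1), show t * t ^ m = t ^ (m + 1) from (pow_succ' t m).symm]
    rw [← pow_succ'] at e1
    rw [div_mul_div_comm, div_mul_div_comm]
    refine (div_eq_one_iff_eq (by simp [*])).2 (by ring)
  linear_combination poch q (t ^ (M + 1)) (r i) * poch q (q * t ^ M) (r i) * h3

theorem nstat_eq (hb : ∀ i, r i ≤ n) (h0 : ∀ i, n ≤ i → r i = 0) {N : ℕ} (hN : n ≤ N) :
    nstat n r = ∑ i ∈ range N, i * r i := by
  rw [nstat, sum_finset_product _ (range N) (fun i => range (r i)) (mem_cellsR_iff hb h0 hN)]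
  exact sum_congr rfl fun i _ => by simp [mul_comm]

theorem prod_one_sub_Bbox (hb : ∀ i, r i ≤ n) (h0 : ∀ i, n ≤ i → r i = 0) {N : ℕ}
    (hN : n ≤ N) :
    ∏ s ∈ cellsR n r, (1 - t ^ N * Bbox s) = ∏ i ∈ range N, poch q (t ^ (N - i)) (r i) := by
  rw [prod_finset_product _ (range N) (fun i => range (r i)) (mem_cellsR_iff hb h0 hN)]
  refine prod_congr rfl fun i hi => prod_congr rfl fun c _ => ?_
  have : t ^ N = t ^ (N - i) * t ^ i := by
    rw [← pow_add, Nat.sub_add_cancel (mem_range.1 hi).le]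
  have h1 := pow_ne_zero i t_ne_zero
  rw [Bbox, zpow_natCast, zpow_neg, zpow_natCast, this]
  field_simp

theorem weight_eq (hr : Antitone r) (hb : ∀ i, r i ≤ n) (h0 : ∀ i, n ≤ i → r i = 0)
    {N : ℕ} (hN : n ≤ N) :
    weight q t (fun i : Fin N => r i)
      = t ^ (2 * nstat n r) / (cfun n r * cfun' n r) *
        ∏ s ∈ cellsR n r, (1 - t ^ N * Bbox s) := by
  have ha : Antitone (fun i : Fin N => r i) := fun i j hij => hr hij
  have h1 : ∀ i : Fin N, ∏ j ∈ Ioi i, pairWeight q t ((j : ℕ) - i - 1) (r i - r j)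
      = ∏ m ∈ range (N - 1 - i), pairWeight q t m (r i - r (i + m + 1)) := by
    intro i
    have h2 := prod_map (Ioi i) Fin.valEmbedding
      (fun j => pairWeight q t (j - i - 1) (r i - r j))
    simp only [Fin.valEmbedding_apply] at h2
    rw [← h2, Fin.map_valEmbedding_Ioi, ← Ico_add_one_left_eq_Ioo, prod_Ico_eq_prod_range,
      show N - (i + 1) = N - 1 - i by omega]
    refine prod_congr rfl fun m _ => ?_
    rw [show (i : ℕ) + 1 + m = i + m + 1 by omega, show (i : ℕ) + m + 1 - i - 1 = m by omega]
  have h3 := cfun_mul_cfun'_eq hr hb h0 hN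
  rw [weight, if_pos ha, prod_congr rfl fun i _ => h1 i,
    prod_one_sub_Bbox hb h0 hN, nstat_eq hb h0 hN]
  have h4 : ∏ i : Fin N, (poch q (q * t ^ (i.rev : ℕ)) (r i))⁻¹
      = (∏ i ∈ range N, poch q (q * t ^ (N - 1 - i)) (r i))⁻¹ := by
    rw [← prod_inv_distrib, ← Fin.prod_univ_eq_prod_range
      (fun i => (poch q (q * t ^ (N - 1 - i)) (r i))⁻¹)]
    refine prod_congr rfl fun i _ => ?_
    rw [Fin.val_rev, show N - (i + 1) = N - 1 - i by omega]
  rw [h4, Fin.sum_univ_eq_sum_range (fun i => i * r i), Fin.prod_univ_eq_prod_range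
    (fun i => ∏ m ∈ range (N - 1 - i), pairWeight q t m (r i - r (i + m + 1)))]
  have h5 : ∏ i ∈ range N, poch q (q * t ^ (N - 1 - i)) (r i) ≠ 0 :=
    prod_ne_zero_iff.2 fun i _ => poch_q_ne_zero _ _
  have h6 : ∏ i ∈ range N, poch q (t ^ (N - i)) (r i) ≠ 0 :=
    prod_ne_zero_iff.2 fun i hi => by
      have := poch_t_ne_zero (N - i - 1) (r i)
      rwa [← pow_succ', Nat.sub_add_cancel (Nat.sub_pos_of_lt (mem_range.1 hi))] at this
  have h7 : cfun n r * cfun' n r ≠ 0 := by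
    intro h
    rw [h, zero_mul] at h3
    exact mul_ne_zero h6 h5 h3.symm
  rw [mul_comm (_ / _), ← mul_div_assoc, eq_div_iff h7]
  field_simp
  linear_combination t ^ (2 * ∑ i ∈ range N, i * r i) * h3

end Hooks

section Rows

variable {n : ℕ}

theorem rows_antitone (l : Nat.Partition n) : Antitone (rows l) := by
  intro i j hij
  have hs : (l.parts.sort (· ≤ ·)).reverse.Pairwise (· ≥ ·) :=
    List.pairwise_reverse.2 (Multiset.pairwise_sort _ _)
  simp only [rows]
  by_cases hj : j < (l.parts.sort (· ≤ ·)).reverse.length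
  · rw [List.getD_eq_getElem _ _ hj, List.getD_eq_getElem _ _ (hij.trans_lt hj)]
    rcases hij.lt_or_eq with h | rfl
    · exact List.pairwise_iff_getElem.1 hs _ _ _ _ h
    · exact le_rfl
  · rw [List.getD_eq_default _ _ (by omega)]
    exact Nat.zero_le _

theorem card_parts_le (l : Nat.Partition n) : l.parts.card ≤ n := by
  have := Multiset.card_nsmul_le_sum (s := l.parts) (a := 1) fun x hx => l.parts_pos hx
  simpa [l.parts_sum] using this

theorem rows_eq_zero (l : Nat.Partition n) {i : ℕ} (hi : n ≤ i) : rows l i = 0 :=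
  List.getD_eq_default _ _ (by simpa using (card_parts_le l).trans hi)

theorem ofFn_rows (l : Nat.Partition n) {N : ℕ} (hN : n ≤ N) :
    List.ofFn (fun i : Fin N => rows l i)
      = (l.parts.sort (· ≤ ·)).reverse ++ List.replicate (N - l.parts.card) 0 := by
  have := card_parts_le l
  refine List.ext_getElem (by simp; omega) fun i h1 h2 => ?_
  simp only [List.getElem_ofFn, rows]
  by_cases hi : i < (l.parts.sort (· ≤ ·)).reverse.length
  · rw [List.getD_eq_getElem _ _ hi, List.getElem_append_left hi]
  · rw [List.getD_eq_default _ _ (by omega), List.getElem_append_right (by omega)]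
    simp

theorem map_rows (l : Nat.Partition n) {N : ℕ} (hN : n ≤ N) :
    (univ : Finset (Fin N)).val.map (fun i : Fin N => rows l i)
      = l.parts + Multiset.replicate (N - l.parts.card) 0 := by
  rw [Fin.univ_val_map, ofFn_rows l hN, ← Multiset.coe_add, Multiset.coe_reverse,
    Multiset.sort_eq, Multiset.coe_replicate]

theorem sum_rows (l : Nat.Partition n) {N : ℕ} (hN : n ≤ N) :
    ∑ i : Fin N, rows l i = n := by
  rw [Finset.sum, map_rows l hN]
  simp [l.parts_sum]

theorem rows_le (l : Nat.Partition n) (i : ℕ) : rows l i ≤ n := by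
  rcases lt_or_ge i n with h | h
  · exact (single_le_sum (f := fun i : Fin n => rows l i) (fun _ _ => Nat.zero_le _)
      (mem_univ (⟨i, h⟩ : Fin n))).trans (sum_rows l le_rfl).le
  · simp [rows_eq_zero l h]

theorem filter_map_rows (l : Nat.Partition n) {N : ℕ} (hN : n ≤ N) :
    ((univ : Finset (Fin N)).val.map (fun i : Fin N => rows l i)).filter (· ≠ 0) = l.parts := by
  rw [map_rows l hN, Multiset.filter_add, Multiset.filter_eq_self.2 fun a ha => (l.parts_pos ha).ne',
    Multiset.filter_eq_nil.2 fun a ha => by simp [Multiset.eq_of_mem_replicate ha], add_zero]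

theorem eq_of_antitone_of_filter_eq {N : ℕ} {r r' : Fin N → ℕ} (hr : Antitone r)
    (hr' : Antitone r')
    (h : (univ.val.map r).filter (· ≠ 0) = (univ.val.map r').filter (· ≠ 0)) : r = r' := by
  have h1 : univ.val.map r = univ.val.map r' := by
    have e : ∀ f : Fin N → ℕ, univ.val.map f = (univ.val.map f).filter (· ≠ 0) +
        Multiset.replicate (N - ((univ.val.map f).filter (· ≠ 0)).card) 0 := by
      intro f
      have e1 := Multiset.filter_add_not (· ≠ 0) (univ.val.map f)
      have e2 := congrArg Multiset.card e1
      rw [Multiset.card_add, Multiset.card_map, card_val, card_univ, Fintype.card_fin] at e2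
      conv_lhs => rw [← e1]
      congr 1
      refine Multiset.eq_replicate.2 ⟨by omega, fun b hb => ?_⟩
      simpa using (Multiset.mem_filter.1 hb).2
    rw [e r, e r', h]
  rw [Fin.univ_val_map, Fin.univ_val_map, Multiset.coe_eq_coe] at h1
  have hs : ∀ {f : Fin N → ℕ}, Antitone f → (List.ofFn f).Pairwise (· ≥ ·) :=
    fun hf => List.pairwise_ofFn.2 fun _ _ hij => hf hij.le
  exact List.ofFn_injective (h1.eq_of_pairwise' (hs hr) (hs hr'))

theorem weightSum_eq_sum_partition {K : Type*} [Field K] {Q T : K} {N : ℕ} (hN : n ≤ N) :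
    weightSum Q T N n = ∑ l : Nat.Partition n, weight Q T (fun i : Fin N => rows l i) := by
  symm
  refine sum_bij_ne_zero (fun l _ _ => fun i : Fin N => rows l i) ?_ ?_ ?_ ?_
  · intro l _ _
    simp [mem_piAntidiag, sum_rows l hN]
  · intro l _ _ l' _ _ h
    refine Nat.Partition.ext ?_
    rw [← filter_map_rows l hN, ← filter_map_rows l' hN]
    exact congrArg (fun f : Fin N → ℕ => (univ.val.map f).filter (· ≠ 0)) h
  · intro r hr hw
    have ha : Antitone r := by
      by_contra h
      exact hw (if_neg h)
    have hs : (univ.val.map r).sum = n := (mem_piAntidiag.1 hr).1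
    have key : (fun i : Fin N => rows (Nat.Partition.ofSums n _ hs) i) = r := by
      refine eq_of_antitone_of_filter_eq (fun i j hij => rows_antitone _ hij) ha ?_
      rw [filter_map_rows _ hN]
      rfl
    exact ⟨Nat.Partition.ofSums n _ hs, mem_univ _, by rwa [key], key⟩
  · intro l _ _
    rfl

end Rows

theorem sum_weight_eq_hSum_of_pow (n N : ℕ) (hN : n ≤ N) :
    ∑ l : Nat.Partition n, t ^ (2 * nstat n (rows l)) / (cfun n (rows l) * cfun' n (rows l)) *
        ∏ s ∈ cellsR n (rows l), (1 - t ^ N * Bbox s)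
      = hSum (fun m => (1 - (t ^ N) ^ m) / ((1 - q ^ m) * (1 - t ^ m))) n := by
  rw [← weightSum_eq_hSum, weightSum_eq_sum_partition hN]
  exact sum_congr rfl fun l _ => (weight_eq (rows_antitone l) (rows_le l)
    (fun _ => rows_eq_zero l) hN).symm

theorem t_pow_injective : Function.Injective (t ^ · : ℕ → F) := by
  intro a b hab
  wlog h : a ≤ b generalizing a b
  · exact (this hab.symm (by omega)).symm
  obtain ⟨c, rfl⟩ := Nat.exists_eq_add_of_le h
  by_contra hc
  have h1 : t ^ a * t ^ c = t ^ a * 1 := by rw [← pow_add, mul_one]; exact hab.symm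
  exact t_pow_ne_one (by omega) (mul_left_cancel₀ (pow_ne_zero a t_ne_zero) h1)

/-- The principal specialization `1, t, …, t^{N-1}` with `t^N` replaced by an arbitrary `u`. -/
theorem sum_partition_eq_hSum (n : ℕ) (u : F) :
    ∑ l : Nat.Partition n, t ^ (2 * nstat n (rows l)) / (cfun n (rows l) * cfun' n (rows l)) *
        ∏ s ∈ cellsR n (rows l), (1 - u * Bbox s)
      = hSum (fun m => (1 - u ^ m) / ((1 - q ^ m) * (1 - t ^ m))) n := by
  let A : Polynomial F := ∑ l : Nat.Partition n,
    Polynomial.C (t ^ (2 * nstat n (rows l)) / (cfun n (rows l) * cfun' n (rows l))) *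
      ∏ s ∈ cellsR n (rows l), (1 - Polynomial.X * Polynomial.C (Bbox s))
  let B : Polynomial F := ∑ μ : Nat.Partition n, Polynomial.C ((zMul μ.parts : F)⁻¹) *
    (μ.parts.map fun m => (1 - Polynomial.X ^ m) *
      Polynomial.C ((1 - q ^ m) * (1 - t ^ m))⁻¹).prod
  have hA : ∀ v, A.eval v = ∑ l : Nat.Partition n,
      t ^ (2 * nstat n (rows l)) / (cfun n (rows l) * cfun' n (rows l)) *
        ∏ s ∈ cellsR n (rows l), (1 - v * Bbox s) := by
    intro v
    simp [A, Polynomial.eval_finsetSum, Polynomial.eval_prod, mul_comm v]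
  have hB : ∀ v, B.eval v = hSum (fun m => (1 - v ^ m) / ((1 - q ^ m) * (1 - t ^ m))) n := by
    intro v
    simp only [B, hSum, Polynomial.eval_finsetSum]
    refine sum_congr rfl fun μ _ => ?_
    rw [Polynomial.eval_mul, Polynomial.eval_C, Polynomial.eval_multiset_prod, Multiset.map_map,
      div_eq_inv_mul]
    simp [div_eq_mul_inv]
  have hAB : A = B := by
    refine Polynomial.eq_of_infinite_eval_eq A B
      (((Set.Ici_infinite n).image t_pow_injective.injOn).mono ?_)
    rintro _ ⟨N, hN, rfl⟩
    exact (hA _).trans ((sum_weight_eq_hSum_of_pow n N hN).trans (hB _).symm)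
  rw [← hA, ← hB, hAB]

end MacdonaldSum

/-- For every `n ≥ 0`:
`∑_{λ⊢n} t^{2n(λ)} / (c_λ(q,t) c'_λ(q,t))
   = ∑_{μ⊢n} 1/(z_μ ∏_i (1−q^{μ_i})(1−t^{μ_i}))`. -/
theorem stmt15 (n : ℕ) :
    (∑ l : Nat.Partition n,
      t ^ (2 * nstat n (rows l)) / (cfun n (rows l) * cfun' n (rows l)))
    = ∑ μ : Nat.Partition n,
        1 / (zmu μ * (μ.parts.map (fun i => (1 - q ^ i) * (1 - t ^ i))).prod) := by
  have h := MacdonaldSum.sum_partition_eq_hSum n 0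
  simp only [zero_mul, sub_zero, Finset.prod_const_one, mul_one] at h
  rw [h, MacdonaldSum.hSum]
  refine Finset.sum_congr rfl fun μ _ => ?_
  have h1 : (μ.parts.map fun m => (1 - (0 : F) ^ m) / ((1 - q ^ m) * (1 - t ^ m))).prod
      = ((μ.parts.map fun i => (1 - q ^ i) * (1 - t ^ i)).prod)⁻¹ := by
    rw [← Multiset.prod_map_inv]
    refine congrArg Multiset.prod (Multiset.map_congr rfl fun m hm => ?_)
    rw [zero_pow (μ.parts_pos hm).ne', sub_zero, one_div]
  rw [h1, one_div, mul_inv, div_eq_inv_mul]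
  rfl
end
end
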